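/- Let s ∈ Ξ with s_k > 0 for all k, and let R_s be the Riesz measure with Laplace transform δ_{−s} on 𝒬. Then for every T ∈ H, the variance function of F(R_s), as a linear operator 𝒵 → 𝒵, satisfies V_{F(R_s)}(ρ(T)I_N) = (n_r/s_r) ρ(T)∘ρ*(T) + Σ_{k=1}^{r−1} (n_k/s_k − n_{k+1}/s_{k+1}) ρ(T)∘ρ(J_k)∘ρ*(T), where J_k := (I_{N_k})_0 ∈ 𝒵 with N_k := n_1+…+n_k. -/

import Mathlib

open Matrix MeasureTheory Finset
open scoped ENNReal

namespace Wishart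

instance {m n α : Type*} [MeasurableSpace α] : MeasurableSpace (Matrix m n α) :=
  inferInstanceAs (MeasurableSpace (m → n → α))

/-- Index set of an `N × N` matrix partitioned into `r + 1` blocks of sizes `n 0, …, n r`. -/
abbrev Idx (r : ℕ) (n : Fin (r + 1) → ℕ+) := Σ k : Fin (r + 1), Fin (n k)

/-- Real matrices over the partitioned index set. -/
abbrev Mat (r : ℕ) (n : Fin (r + 1) → ℕ+) := Matrix (Idx r n) (Idx r n) ℝ

variable {r : ℕ} {n : Fin (r + 1) → ℕ+}

/-- The `(l,k)` block of a partitioned matrix. -/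
def blk (x : Mat r n) (l k : Fin (r + 1)) : Matrix (Fin (n l)) (Fin (n k)) ℝ :=
  Matrix.of fun a b => x ⟨l, a⟩ ⟨k, b⟩

variable (V : ∀ l k : Fin (r + 1), Submodule ℝ (Matrix (Fin (n l)) (Fin (n k)) ℝ))

/-- Condition (V1): `A ∈ 𝒱_{lk}`, `B ∈ 𝒱_{ki}` implies `A B ∈ 𝒱_{li}` for `i < k < l`. -/
def CondV1 : Prop := ∀ i k l : Fin (r + 1), i < k → k < l →
  ∀ A ∈ V l k, ∀ B ∈ V k i, A * B ∈ V l i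

/-- Condition (V2): `A ∈ 𝒱_{li}`, `B ∈ 𝒱_{ki}` implies `A Bᵀ ∈ 𝒱_{lk}` for `i < k < l`. -/
def CondV2 : Prop := ∀ i k l : Fin (r + 1), i < k → k < l →
  ∀ A ∈ V l i, ∀ B ∈ V k i, A * Bᵀ ∈ V l k

/-- Condition (V3): `A ∈ 𝒱_{lk}` implies `A Aᵀ ∈ ℝ I`. -/
def CondV3 : Prop := ∀ k l : Fin (r + 1), k < l →
  ∀ A ∈ V l k, ∃ c : ℝ, A * Aᵀ = c • (1 : Matrix (Fin (n l)) (Fin (n l)) ℝ)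

/-- The space `𝒵` of symmetric matrices with lower blocks in `𝒱_{lk}` and scalar diagonal
blocks. -/
def Zspace : Set (Mat r n) :=
  {x | x.IsSymm ∧ (∀ k l : Fin (r + 1), k < l → blk x l k ∈ V l k) ∧
    ∀ k : Fin (r + 1), ∃ c : ℝ, ∀ a b : Fin (n k),
      x ⟨k, a⟩ ⟨k, b⟩ = if a = b then c else 0}

/-- The trace inner product `⟨x, y⟩ = tr (x y)`. -/
def tip (x y : Mat r n) : ℝ := (x * y).trace

/-- The homogeneous cone `𝒫 = 𝒵 ∩ Sym₊(N, ℝ)`. -/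
def Pcone : Set (Mat r n) := {x | x ∈ Zspace V ∧ x.PosDef}

/-- The dual cone `𝒬 = {ξ ∈ 𝒵 : ⟨ξ, x⟩ > 0 for all nonzero x in the closure of 𝒫}`. -/
def Qcone : Set (Mat r n) :=
  {ξ | ξ ∈ Zspace V ∧ ∀ x ∈ closure (Pcone V), x ≠ 0 → 0 < tip ξ x}

/-- The group `H` of block lower triangular matrices with strictly lower blocks in `𝒱_{lk}`
and positive scalar diagonal blocks. -/
def Hgrp : Set (Mat r n) :=
  {T | (∀ k l : Fin (r + 1), l < k → blk T l k = 0) ∧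
    (∀ k l : Fin (r + 1), k < l → blk T l k ∈ V l k) ∧
    ∀ k : Fin (r + 1), ∃ t : ℝ, 0 < t ∧ ∀ a b : Fin (n k),
      T ⟨k, a⟩ ⟨k, b⟩ = if a = b then t else 0}

/-- `ρ(T) x = T x Tᵀ`. -/
def rhoM (T x : Mat r n) : Mat r n := T * x * Tᵀ

/-- The diagonal scalar `t_{kk}` of a matrix with scalar diagonal blocks. -/
def tdiag (T : Mat r n) (k : Fin (r + 1)) : ℝ :=
  T ⟨k, ⟨0, (n k).2⟩⟩ ⟨k, ⟨0, (n k).2⟩⟩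

/-- The one-dimensional representation `χ_s(T) = ∏_k t_{kk}^{2 s_k}`. -/
noncomputable def chi (s : Fin (r + 1) → ℝ) (T : Mat r n) : ℝ :=
  ∏ k : Fin (r + 1), tdiag T k ^ (2 * s k)

/-- `½ Σ_{i<k} ε_i dim 𝒱_{ki}`. -/
noncomputable def xiBound (ε : Fin (r + 1) → Bool) (k : Fin (r + 1)) : ℝ :=
  (1 / 2) * ∑ i ∈ Finset.univ.filter (fun i => i < k),
    (if ε i then (Module.finrank ℝ (V k i) : ℝ) else 0)

/-- The Gindikin set `Ξ`. -/
def XiSet : Set (Fin (r + 1) → ℝ) :=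
  ⋃ ε : Fin (r + 1) → Bool,
    {s | ∀ k, (ε k = true → xiBound V ε k < s k) ∧ (ε k = false → s k = xiBound V ε k)}

/-- `½ Σ_{l>k} ε_l dim 𝒱_{lk}`. -/
noncomputable def frakBound (ε : Fin (r + 1) → Bool) (k : Fin (r + 1)) : ℝ :=
  (1 / 2) * ∑ l ∈ Finset.univ.filter (fun l => k < l),
    (if ε l then (Module.finrank ℝ (V l k) : ℝ) else 0)

/-- The Gindikin set `𝔛`. -/
def frakX : Set (Fin (r + 1) → ℝ) :=
  ⋃ ε : Fin (r + 1) → Bool,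
    {s | ∀ k, (ε k = true → frakBound V ε k < s k) ∧ (ε k = false → s k = frakBound V ε k)}

/-- Laplace transform `L_μ(θ) = ∫ e^{-⟨θ,x⟩} dμ(x)` (with values in `[0,∞]`). -/
noncomputable def laplace (μ : Measure (Mat r n)) (θ : Mat r n) : ℝ≥0∞ :=
  ∫⁻ x, ENNReal.ofReal (Real.exp (-(tip θ x))) ∂μ

/-- Real-valued Laplace transform. -/
noncomputable def laplaceR (μ : Measure (Mat r n)) (θ : Mat r n) : ℝ :=
  ∫ x, Real.exp (-(tip θ x)) ∂μ

/-- Mean of the natural-exponential-family member `P(θ,μ)`, computed entrywise: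
`m_μ(θ) = L_μ(θ)⁻¹ ∫ x e^{-⟨θ,x⟩} dμ(x)`. -/
noncomputable def meanMap (μ : Measure (Mat r n)) (θ : Mat r n) : Mat r n :=
  Matrix.of fun p q => (laplaceR μ θ)⁻¹ * ∫ x, Real.exp (-(tip θ x)) * x p q ∂μ

/-- Covariance operator of `P(θ,μ)` with mean `m`, applied to `ξ ∈ 𝒵` (entrywise):
`V ξ = ∫ ⟨ξ, x - m⟩ (x - m) dP(θ,μ)(x)`. -/
noncomputable def varOp (μ : Measure (Mat r n)) (θ m ξ : Mat r n) : Mat r n :=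
  Matrix.of fun p q =>
    (laplaceR μ θ)⁻¹ * ∫ x, Real.exp (-(tip θ x)) * tip ξ (x - m) * ((x - m) p q) ∂μ

/-- Leading principal submatrix `y_{{1:k}}` consisting of the blocks with indices `≤ k`. -/
def lead (k : Fin (r + 1)) (y : Mat r n) :
    Matrix {p : Idx r n // p.1 ≤ k} {p : Idx r n // p.1 ≤ k} ℝ :=
  Matrix.of fun p q => y p.1 q.1

/-- Zero-padding `z₀` of a matrix `z` defined on the blocks with indices `≤ k`. -/
def pad (k : Fin (r + 1)) (z : Matrix {p : Idx r n // p.1 ≤ k} {p : Idx r n // p.1 ≤ k} ℝ) :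
    Mat r n :=
  Matrix.of fun p q => if h : p.1 ≤ k ∧ q.1 ≤ k then z ⟨p, h.1⟩ ⟨q, h.2⟩ else 0

/-- `J_k = (I_{N_k})₀`. -/
def Jmat (k : Fin (r + 1)) : Mat r n := pad k 1

/-- Parameters of elements of `W_i`: the scalar `x_{ii}` and the blocks `X_{li}`. -/
abbrev Wparam (r : ℕ) (n : Fin (r + 1) → ℕ+) (i : Fin (r + 1)) :=
  ℝ × ∀ l : Fin (r + 1), Matrix (Fin (n l)) (Fin (n i)) ℝ

/-- The `N × n_i` matrix in `W_i` with `i`-th block row `x_{ii} I` and `l`-th block row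
`X_{li}` for `l > i`. -/
def toW (i : Fin (r + 1)) (p : Wparam r n i) : Matrix (Idx r n) (Fin (n i)) ℝ :=
  Matrix.of fun q b =>
    if q.1 = i then (if (q.2 : ℕ) = (b : ℕ) then p.1 else 0)
    else if i < q.1 then p.2 q.1 q.2 b else 0

/-- A parameter tuple gives an honest element of `W_i`: blocks lie in `𝒱_{li}` and vanish
for `l ≤ i`. -/
def WGood (i : Fin (r + 1)) (p : Wparam r n i) : Prop :=
  (∀ l : Fin (r + 1), i < l → p.2 l ∈ V l i) ∧ (∀ l : Fin (r + 1), ¬ i < l → p.2 l = 0)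

/-- The inner product `(A|B)` on `𝒱_{lk}`, characterized by `(ABᵀ + BAᵀ)/2 = (A|B) I`. -/
noncomputable def bip (l : Fin (r + 1)) {k : Fin (r + 1)}
    (A B : Matrix (Fin (n l)) (Fin (n k)) ℝ) : ℝ :=
  (A * Bᵀ).trace / (n l : ℝ)

open scoped Classical in
/-- The generalized power function `Δ_s` on `𝒫`, defined by `Δ_s(ρ(T) I) = χ_s(T)`. -/
noncomputable def DeltaDef (s : Fin (r + 1) → ℝ) (x : Mat r n) : ℝ :=
  if h : ∃ T, T ∈ Hgrp V ∧ x = rhoM T 1 then chi s h.choose else 0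

/-- Index set for the block diagonal matrix `Φ(ξ) = diag(φ_0(ξ), …, φ_r(ξ))`,
where `φ_i(ξ)` is of size `m_i = mdc i + 1`. -/
abbrev DIdx (r : ℕ) (mdc : Fin (r + 1) → ℕ) := Σ i : Fin (r + 1), Fin (mdc i + 1)

/-- The block diagonal matrix `Φ(ξ) = diag(φ_0(ξ), …, φ_r(ξ))`. -/
def PhiMat {mdc : Fin (r + 1) → ℕ}
    (φ : ∀ i : Fin (r + 1), Mat r n → Matrix (Fin (mdc i + 1)) (Fin (mdc i + 1)) ℝ)
    (ξ : Mat r n) : Matrix (DIdx r mdc) (DIdx r mdc) ℝ :=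
  Matrix.of fun p q =>
    if h : p.1 = q.1 then φ p.1 ξ p.2 (Fin.cast (by rw [h]) q.2) else 0

/-- `Φ(I_N)^{-1/2}`: the inverse square root of the (diagonal, positive) matrix `Φ(I_N)`. -/
noncomputable def PhiISqrtInv {mdc : Fin (r + 1) → ℕ}
    (φ : ∀ i : Fin (r + 1), Mat r n → Matrix (Fin (mdc i + 1)) (Fin (mdc i + 1)) ℝ) :
    Matrix (DIdx r mdc) (DIdx r mdc) ℝ :=
  Matrix.diagonal fun p => (PhiMat φ (1 : Mat r n) p p) ^ (-(1 / 2) : ℝ)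

section LowerTriangular

/-- The space `𝒵` as a submodule of the space of all matrices. -/
def Zsub : Submodule ℝ (Mat r n) where
  carrier := Zspace V
  zero_mem' := ⟨by simp [Matrix.IsSymm], fun k l _ => (V l k).zero_mem, fun k => ⟨0, by simp⟩⟩
  add_mem' := by
    rintro x y ⟨hx, hx', hx''⟩ ⟨hy, hy', hy''⟩
    refine ⟨hx.add hy, fun k l h => (V l k).add_mem (hx' k l h) (hy' k l h), fun k => ?_⟩
    obtain ⟨c, hc⟩ := hx'' k
    obtain ⟨d, hd⟩ := hy'' k
    refine ⟨c + d, fun a b => ?_⟩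
    rw [Matrix.add_apply, hc, hd]
    split_ifs <;> simp
  smul_mem' := by
    rintro t x ⟨hx, hx', hx''⟩
    refine ⟨hx.smul t, fun k l h => (V l k).smul_mem t (hx' k l h), fun k => ?_⟩
    obtain ⟨c, hc⟩ := hx'' k
    refine ⟨t * c, fun a b => ?_⟩
    rw [Matrix.smul_apply, hc]
    split_ifs <;> simp

lemma blk_add (x y : Mat r n) (l k : Fin (r + 1)) : blk (x + y) l k = blk x l k + blk y l k := rfl

lemma blk_smul (t : ℝ) (x : Mat r n) (l k : Fin (r + 1)) : blk (t • x) l k = t • blk x l k := rfl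

lemma blk_transpose (x : Mat r n) (l k : Fin (r + 1)) : blk xᵀ l k = (blk x k l)ᵀ := rfl

lemma blk_mul (x y : Mat r n) (l k : Fin (r + 1)) :
    blk (x * y) l k = ∑ j, blk x l j * blk y j k := by
  ext a b
  simp only [blk, Matrix.of_apply, Matrix.mul_apply, Matrix.sum_apply, Fintype.sum_sigma]

lemma blk_eq_smul_one_iff {x : Mat r n} {k : Fin (r + 1)} {c : ℝ} :
    blk x k k = c • 1 ↔ ∀ a b : Fin (n k), x ⟨k, a⟩ ⟨k, b⟩ = if a = b then c else 0 := by
  simp only [← Matrix.ext_iff, blk, Matrix.of_apply, Matrix.smul_apply, Matrix.one_apply,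
    smul_eq_mul, mul_ite, mul_one, mul_zero]

lemma tdiag_of_blk {x : Mat r n} {k : Fin (r + 1)} {c : ℝ} (h : blk x k k = c • 1) :
    tdiag x k = c := by
  rw [tdiag, blk_eq_smul_one_iff.1 h, if_pos rfl]

/-- The algebra of block lower triangular matrices with strictly lower blocks in `𝒱_{lk}` and
scalar diagonal blocks. -/
def lowerAlg : Submodule ℝ (Mat r n) where
  carrier := {T | (∀ k l, l < k → blk T l k = 0) ∧ (∀ k l, k < l → blk T l k ∈ V l k) ∧
    ∀ k, ∃ c : ℝ, blk T k k = c • 1}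
  zero_mem' := ⟨fun _ _ _ => rfl, fun k l _ => (V l k).zero_mem, fun k => ⟨0, by rw [zero_smul]; rfl⟩⟩
  add_mem' := by
    rintro x y ⟨hx, hx', hx''⟩ ⟨hy, hy', hy''⟩
    refine ⟨fun k l h => ?_, fun k l h => (V l k).add_mem (hx' k l h) (hy' k l h), fun k => ?_⟩
    · rw [blk_add, hx k l h, hy k l h, add_zero]
    · obtain ⟨c, hc⟩ := hx'' k
      obtain ⟨d, hd⟩ := hy'' k
      exact ⟨c + d, by rw [blk_add, hc, hd, add_smul]⟩
  smul_mem' := by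
    rintro t x ⟨hx, hx', hx''⟩
    refine ⟨fun k l h => ?_, fun k l h => (V l k).smul_mem t (hx' k l h), fun k => ?_⟩
    · rw [blk_smul, hx k l h, smul_zero]
    · obtain ⟨c, hc⟩ := hx'' k
      exact ⟨t * c, by rw [blk_smul, hc, smul_smul]⟩

variable {V}

lemma blk_self_of_mem_lowerAlg {T : Mat r n} (hT : T ∈ lowerAlg V) (k : Fin (r + 1)) :
    blk T k k = tdiag T k • 1 := by
  obtain ⟨c, hc⟩ := hT.2.2 k
  rw [tdiag_of_blk hc, hc]

lemma mem_Hgrp_iff {T : Mat r n} : T ∈ Hgrp V ↔ T ∈ lowerAlg V ∧ ∀ k, 0 < tdiag T k := by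
  constructor
  · rintro ⟨h1, h2, h3⟩
    refine ⟨⟨h1, h2, fun k => ?_⟩, fun k => ?_⟩ <;> obtain ⟨t, ht, h⟩ := h3 k
    · exact ⟨t, blk_eq_smul_one_iff.2 h⟩
    · rwa [tdiag_of_blk (blk_eq_smul_one_iff.2 h)]
  · rintro ⟨h, hpos⟩
    exact ⟨h.1, h.2.1, fun k => ⟨_, hpos k, blk_eq_smul_one_iff.1 (blk_self_of_mem_lowerAlg h k)⟩⟩

lemma blk_mul_self_of_mem_lowerAlg {A B : Mat r n} (hA : A ∈ lowerAlg V) (hB : B ∈ lowerAlg V)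
    (k : Fin (r + 1)) : blk (A * B) k k = (tdiag A k * tdiag B k) • 1 := by
  rw [blk_mul, Finset.sum_eq_single k]
  · rw [blk_self_of_mem_lowerAlg hA, blk_self_of_mem_lowerAlg hB, smul_mul_smul_comm, one_mul]
  · intro j _ hj
    rcases lt_or_gt_of_ne hj with h | h
    · rw [hB.1 k j h, Matrix.mul_zero]
    · rw [hA.1 j k h, Matrix.zero_mul]
  · simp

lemma tdiag_mul {A B : Mat r n} (hA : A ∈ lowerAlg V) (hB : B ∈ lowerAlg V)
    (k : Fin (r + 1)) : tdiag (A * B) k = tdiag A k * tdiag B k :=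
  tdiag_of_blk (blk_mul_self_of_mem_lowerAlg hA hB k)

lemma mul_mem_lowerAlg (hV1 : CondV1 V) {A B : Mat r n} (hA : A ∈ lowerAlg V)
    (hB : B ∈ lowerAlg V) : A * B ∈ lowerAlg V := by
  refine ⟨fun k l h => ?_, fun k l h => ?_, fun k => ⟨_, blk_mul_self_of_mem_lowerAlg hA hB k⟩⟩
  · rw [blk_mul]
    refine Finset.sum_eq_zero fun j _ => ?_
    rcases lt_or_ge l j with h' | h'
    · rw [hA.1 j l h', Matrix.zero_mul]
    · rw [hB.1 k j (h'.trans_lt h), Matrix.mul_zero]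
  · rw [blk_mul]
    refine (V l k).sum_mem fun j _ => ?_
    rcases lt_trichotomy j k with h' | rfl | h'
    · rw [hB.1 k j h', Matrix.mul_zero]
      exact (V l k).zero_mem
    · rw [blk_self_of_mem_lowerAlg hB, Matrix.mul_smul, Matrix.mul_one]
      exact (V l j).smul_mem _ (hA.2.1 _ _ h)
    · rcases lt_trichotomy j l with h'' | rfl | h''
      · exact hV1 k j l h' h'' _ (hA.2.1 _ _ h'') _ (hB.2.1 _ _ h')
      · rw [blk_self_of_mem_lowerAlg hA, Matrix.smul_mul, Matrix.one_mul]
        exact (V j k).smul_mem _ (hB.2.1 _ _ h)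
      · rw [hA.1 j l h'', Matrix.zero_mul]
        exact (V l k).zero_mem

lemma blk_one (l k : Fin (r + 1)) (h : l ≠ k) : blk (1 : Mat r n) l k = 0 := by
  ext a b
  simp [blk, h]

lemma blk_one_self (k : Fin (r + 1)) : blk (1 : Mat r n) k k = (1 : ℝ) • 1 := by
  ext a b
  simp [blk, Matrix.one_apply]

lemma one_mem_lowerAlg : (1 : Mat r n) ∈ lowerAlg V :=
  ⟨fun k l h => blk_one l k h.ne, fun k l h => by rw [blk_one l k h.ne']; exact (V l k).zero_mem,
    fun k => ⟨1, blk_one_self k⟩⟩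

lemma det_pos_of_mem_Hgrp {T : Mat r n} (hT : T ∈ Hgrp V) : 0 < T.det := by
  obtain ⟨h, hpos⟩ := mem_Hgrp_iff.1 hT
  have htri : Tᵀ.BlockTriangular Sigma.fst := fun p q hpq => by
    have := congrFun (congrFun (h.1 p.1 q.1 hpq) q.2) p.2
    simpa [blk] using this
  rw [← Matrix.det_transpose, htri.det]
  refine Finset.prod_pos fun k _ => ?_
  have : Tᵀ.toSquareBlock Sigma.fst k = tdiag T k • 1 := by
    ext ⟨⟨i, a⟩, hi⟩ ⟨⟨j, b⟩, hj⟩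
    dsimp at hi hj
    subst hi
    subst hj
    have := congrFun (congrFun (blk_self_of_mem_lowerAlg h j) b) a
    simp only [blk, Matrix.of_apply, Matrix.smul_apply, Matrix.one_apply] at this
    simp [Matrix.toSquareBlock_def, this, Matrix.one_apply, eq_comm]
  rw [this, Matrix.det_smul, Matrix.det_one, mul_one]
  exact pow_pos (hpos k) _

lemma inv_mem_Hgrp (hV1 : CondV1 V) {T : Mat r n} (hT : T ∈ Hgrp V) : T⁻¹ ∈ Hgrp V := by
  obtain ⟨h, hpos⟩ := mem_Hgrp_iff.1 hT
  have hu : IsUnit T.det := (det_pos_of_mem_Hgrp hT).ne'.isUnit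
  let f : lowerAlg V →ₗ[ℝ] lowerAlg V :=
    (LinearMap.mulLeft ℝ T).restrict fun X hX => mul_mem_lowerAlg hV1 h hX
  have hf : Function.Injective f := fun X Y hXY => by
    have : T * X.1 = T * Y.1 := congrArg Subtype.val hXY
    refine Subtype.ext ?_
    rw [← Matrix.nonsing_inv_mul_cancel_left T X.1 hu, this,
      Matrix.nonsing_inv_mul_cancel_left T Y.1 hu]
  obtain ⟨X, hX⟩ := LinearMap.injective_iff_surjective.1 hf ⟨1, one_mem_lowerAlg⟩
  have hX' : T * X.1 = 1 := congrArg Subtype.val hX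
  rw [Matrix.inv_eq_right_inv hX', mem_Hgrp_iff]
  refine ⟨X.2, fun k => ?_⟩
  have := tdiag_mul h X.2 k
  rw [hX', tdiag_of_blk (blk_one_self k)] at this
  exact (pos_iff_pos_of_mul_pos (this ▸ one_pos)).1 (hpos k)

lemma mul_transpose_self_mem_Zspace (hV2 : CondV2 V) (hV3 : CondV3 V) {A : Mat r n}
    (hA : A ∈ lowerAlg V) : A * Aᵀ ∈ Zspace V := by
  refine ⟨by simp [Matrix.IsSymm], fun k l h => ?_, fun k => ?_⟩
  · simp only [blk_mul, blk_transpose]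
    refine (V l k).sum_mem fun j _ => ?_
    rcases lt_trichotomy j k with h' | rfl | h'
    · exact hV2 j k l h' h _ (hA.2.1 _ _ (h'.trans h)) _ (hA.2.1 _ _ h')
    · rw [blk_self_of_mem_lowerAlg hA, Matrix.transpose_smul, Matrix.transpose_one,
        Matrix.mul_smul, Matrix.mul_one]
      exact (V l j).smul_mem _ (hA.2.1 _ _ h)
    · rw [hA.1 j k h', Matrix.transpose_zero, Matrix.mul_zero]
      exact (V l k).zero_mem
  · have hj : ∀ j, ∃ c : ℝ, blk A k j * (blk A k j)ᵀ = c • 1 := fun j => by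
      rcases lt_trichotomy j k with h | rfl | h
      · exact hV3 j k h _ (hA.2.1 _ _ h)
      · rw [blk_self_of_mem_lowerAlg hA, Matrix.transpose_smul, Matrix.transpose_one,
          smul_mul_smul_comm, Matrix.one_mul]
        exact ⟨_, rfl⟩
      · exact ⟨0, by rw [hA.1 j k h, Matrix.zero_mul, zero_smul]⟩
    choose c hc using hj
    refine ⟨∑ j, c j, blk_eq_smul_one_iff.1 ?_⟩
    simp only [blk_mul, blk_transpose, hc, Finset.sum_smul]

lemma mul_transpose_add_mem_Zspace (hV2 : CondV2 V) (hV3 : CondV3 V) {A B : Mat r n}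
    (hA : A ∈ lowerAlg V) (hB : B ∈ lowerAlg V) : A * Bᵀ + B * Aᵀ ∈ Zspace V := by
  have h := (Zsub V).sub_mem ((Zsub V).sub_mem
    (mul_transpose_self_mem_Zspace hV2 hV3 ((lowerAlg V).add_mem hA hB))
    (mul_transpose_self_mem_Zspace hV2 hV3 hA)) (mul_transpose_self_mem_Zspace hV2 hV3 hB)
  have e : A * Bᵀ + B * Aᵀ = (A + B) * (A + B)ᵀ - A * Aᵀ - B * Bᵀ := by
    rw [Matrix.transpose_add]
    noncomm_ring
  rw [e]
  exact h

/-- The block lower triangular part of `x` with block row `l` multiplied by `a l`, and the diagonal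
blocks halved. -/
noncomputable def lowerPart (a : Fin (r + 1) → ℝ) (x : Mat r n) : Mat r n :=
  Matrix.of fun p q =>
    if q.1 < p.1 then a p.1 * x p q else if q.1 = p.1 then a p.1 * x p q / 2 else 0

lemma lowerPart_mem (a : Fin (r + 1) → ℝ) {x : Mat r n} (hx : x ∈ Zspace V) :
    lowerPart a x ∈ lowerAlg V := by
  refine ⟨fun k l h => ?_, fun k l h => ?_, fun k => ?_⟩
  · ext i j
    simp [blk, lowerPart, h.le.not_gt, h.ne']
  · convert (V l k).smul_mem (a l) (hx.2.1 k l h) using 1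
    ext i j
    simp [blk, lowerPart, h]
  · obtain ⟨c, hc⟩ := hx.2.2 k
    refine ⟨a k * c / 2, blk_eq_smul_one_iff.2 fun i j => ?_⟩
    simp only [lowerPart, Matrix.of_apply, lt_irrefl, if_false, if_true, hc]
    split_ifs <;> simp

lemma lowerPart_add_transpose {x : Mat r n} (hx : x ∈ Zspace V) :
    lowerPart (fun _ => 1) x + (lowerPart (fun _ => 1) x)ᵀ = x := by
  ext p q
  have hs : x q p = x p q := hx.1.apply p q
  simp only [Matrix.add_apply, Matrix.transpose_apply, lowerPart, Matrix.of_apply, hs]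
  rcases lt_trichotomy p.1 q.1 with h | h | h
  · simp [h, h.le.not_gt, h.ne']
  · simp [h]
  · simp [h, h.le.not_gt, h.ne']

lemma rhoM_mem_Zspace (hV1 : CondV1 V) (hV2 : CondV2 V) (hV3 : CondV3 V) {T x : Mat r n}
    (hT : T ∈ lowerAlg V) (hx : x ∈ Zspace V) : rhoM T x ∈ Zspace V := by
  have h := mul_transpose_add_mem_Zspace hV2 hV3
    (mul_mem_lowerAlg hV1 hT (lowerPart_mem (fun _ => 1) hx)) hT
  rw [rhoM, ← lowerPart_add_transpose hx]
  convert h using 1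
  rw [Matrix.transpose_mul]
  noncomm_ring

lemma one_mem_Zspace : (1 : Mat r n) ∈ Zspace V :=
  ⟨by simp [Matrix.IsSymm], fun k l h => by rw [blk_one l k h.ne']; exact (V l k).zero_mem,
    fun k => ⟨1, blk_eq_smul_one_iff.1 (blk_one_self k)⟩⟩

end LowerTriangular

section Cones

lemma tip_add_left (x y z : Mat r n) : tip (x + y) z = tip x z + tip y z := by
  simp [tip, Matrix.add_mul]

lemma tip_add_right (x y z : Mat r n) : tip x (y + z) = tip x y + tip x z := by
  simp [tip, Matrix.mul_add]

lemma tip_smul_left (c : ℝ) (x y : Mat r n) : tip (c • x) y = c * tip x y := by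
  simp [tip]

lemma tip_smul_right (c : ℝ) (x y : Mat r n) : tip x (c • y) = c * tip x y := by
  simp [tip]

lemma tip_sub_left (x y z : Mat r n) : tip (x - y) z = tip x z - tip y z := by
  simp [tip, Matrix.sub_mul]

lemma tip_sub_right (x y z : Mat r n) : tip x (y - z) = tip x y - tip x z := by
  simp [tip, Matrix.mul_sub]

lemma tip_eq_sum (x y : Mat r n) : tip x y = ∑ p, ∑ q, x p q * y q p := by
  simp [tip, Matrix.trace, Matrix.mul_apply]

lemma tip_self_pos {x : Mat r n} (hx : x.IsSymm) (h : x ≠ 0) : 0 < tip x x := by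
  have e : tip x x = (xᴴ * x).trace := by
    rw [Matrix.conjTranspose_eq_transpose_of_trivial, hx.eq, tip]
  rw [e]
  exact (Matrix.posSemidef_conjTranspose_mul_self x).trace_nonneg.lt_of_ne'
    (Matrix.trace_conjTranspose_mul_self_eq_zero_iff.not.2 h)

/-- The trace inner product as a bilinear form. -/
def tipForm : LinearMap.BilinForm ℝ (Mat r n) :=
  LinearMap.mk₂ ℝ tip tip_add_left tip_smul_left tip_add_right tip_smul_right

lemma tipForm_apply (x y : Mat r n) : tipForm x y = tip x y := rfl

lemma tip_continuous : Continuous fun z : Mat r n × Mat r n => tip z.1 z.2 := by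
  unfold tip
  fun_prop

lemma tip_measurable (x : Mat r n) : Measurable (tip x) := by
  have : tip x = fun y => ∑ p, ∑ q, x p q * y q p := funext (tip_eq_sum x)
  rw [this]
  refine Finset.measurable_sum _ fun p _ => Finset.measurable_sum _ fun q _ =>
    Measurable.const_mul ?_ _
  exact (measurable_pi_apply p).comp (measurable_pi_apply q)

variable {V}

/-- Every linear functional is represented on `𝒵` by an element of `𝒵`. -/
lemma exists_tip_eq (V : ∀ l k : Fin (r + 1), Submodule ℝ (Matrix (Fin (n l)) (Fin (n k)) ℝ))
    (φ : Mat r n →ₗ[ℝ] ℝ) : ∃ e ∈ Zspace V, ∀ x ∈ Zspace V, tip e x = φ x := by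
  let B : LinearMap.BilinForm ℝ (Zsub V) := tipForm.restrict (Zsub V)
  have hB : Function.Injective B := (injective_iff_map_eq_zero B).2 fun x hx => by
    by_contra h
    have h1 := tip_self_pos x.2.1 (fun h' => h (Subtype.ext h'))
    exact h1.ne' (LinearMap.congr_fun hx x)
  have hs : Function.Surjective B :=
    (LinearMap.injective_iff_surjective_of_finrank_eq_finrank
      Subspace.dual_finrank_eq.symm).1 hB
  obtain ⟨e, he⟩ := hs (φ.comp (Zsub V).subtype)
  exact ⟨e.1, e.2, fun x hx => LinearMap.congr_fun he ⟨x, hx⟩⟩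

lemma eq_of_tip_eq {x y : Mat r n} (hx : x ∈ Zspace V) (hy : y ∈ Zspace V)
    (h : ∀ z ∈ Zspace V, tip x z = tip y z) : x = y := by
  by_contra hne
  have hz := (Zsub V).sub_mem hx hy
  have := tip_self_pos hz.1 (sub_ne_zero.2 hne)
  rw [tip_sub_left, h _ hz, sub_self] at this
  exact this.false

lemma rhoM_ne_zero {T x : Mat r n} (hT : IsUnit T.det) (hx : x ≠ 0) : rhoM T x ≠ 0 := by
  intro h
  apply hx
  have h1 : T * x = 0 := by
    rw [← Matrix.mul_nonsing_inv_cancel_right Tᵀ (T * x) (by rwa [Matrix.det_transpose])]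
    rw [rhoM] at h
    rw [h, Matrix.zero_mul]
  rw [← Matrix.nonsing_inv_mul_cancel_left T x hT, h1, Matrix.mul_zero]

lemma closure_Pcone_subset {x : Mat r n} (hx : x ∈ closure (Pcone V)) :
    x ∈ Zspace V ∧ x.PosSemidef := by
  have hclosed : IsClosed {x : Mat r n | x ∈ Zspace V ∧ x.PosSemidef} := by
    have hZ : IsClosed (Zspace V) := (Zsub V).closed_of_finiteDimensional
    have hP : IsClosed {x : Mat r n | ∀ v, 0 ≤ star v ⬝ᵥ (x *ᵥ v)} := by
      simp only [Set.ofPred_forall]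
      exact isClosed_iInter fun v => isClosed_le continuous_const (by fun_prop)
    convert hZ.inter hP using 1
    ext x
    refine and_congr_right fun h => ?_
    rw [Matrix.posSemidef_iff_dotProduct_mulVec]
    refine ⟨fun h' => h'.2, fun h' => ⟨?_, h'⟩⟩
    rw [Matrix.IsHermitian, Matrix.conjTranspose_eq_transpose_of_trivial, h.1.eq]
  have hsub : Pcone V ⊆ {x : Mat r n | x ∈ Zspace V ∧ x.PosSemidef} :=
    fun y hy => And.intro hy.1 hy.2.posSemidef
  exact closure_minimal hsub hclosed hx

lemma rhoM_one_mem_Pcone (hV2 : CondV2 V) (hV3 : CondV3 V) {T : Mat r n} (hT : T ∈ Hgrp V) :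
    rhoM T 1 ∈ Pcone V := by
  have e : rhoM T 1 = T * Tᵀ := by rw [rhoM, Matrix.mul_one]
  refine ⟨e ▸ mul_transpose_self_mem_Zspace hV2 hV3 (mem_Hgrp_iff.1 hT).1, ?_⟩
  rw [e, ← Matrix.conjTranspose_eq_transpose_of_trivial]
  exact Matrix.PosDef.mul_conjTranspose_self T
    (Matrix.vecMul_injective_of_isUnit
      ((Matrix.isUnit_iff_isUnit_det T).2 (det_pos_of_mem_Hgrp hT).ne'.isUnit))

lemma mem_Qcone_of_tip_eq {T θ : Mat r n} (hT : T ∈ Hgrp V) (hθ : θ ∈ Zspace V)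
    (h : ∀ x ∈ Zspace V, tip θ x = (rhoM T x).trace) : θ ∈ Qcone V := by
  refine ⟨hθ, fun x hx hx0 => ?_⟩
  obtain ⟨hxZ, hxP⟩ := closure_Pcone_subset hx
  have hpsd : (rhoM T x).PosSemidef := by
    rw [rhoM, ← Matrix.conjTranspose_eq_transpose_of_trivial]
    exact hxP.mul_mul_conjTranspose_same T
  rw [h x hxZ]
  exact hpsd.trace_nonneg.lt_of_ne'
    (hpsd.trace_eq_zero_iff.not.2 (rhoM_ne_zero (det_pos_of_mem_Hgrp hT).ne'.isUnit hx0))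

lemma smul_mem_closure_Pcone {x : Mat r n} (hx : x ∈ closure (Pcone V)) {c : ℝ} (hc : 0 < c) :
    c • x ∈ closure (Pcone V) :=
  map_mem_closure (continuous_const_smul c) hx fun _ hy =>
    ⟨(Zsub V).smul_mem c hy.1, hy.2.smul hc⟩

open Topology in
/-- `𝒬` is relatively open in `𝒵`. -/
lemma eventually_add_smul_mem_Qcone {θ α : Mat r n} (hθ : θ ∈ Qcone V) (hα : α ∈ Zspace V) :
    ∀ᶠ u : ℝ in 𝓝 0, θ + u • α ∈ Qcone V := by
  let _ : NormedAddCommGroup (Mat r n) := Matrix.normedAddCommGroup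
  let _ : NormedSpace ℝ (Mat r n) := Matrix.normedSpace
  have : ProperSpace (Mat r n) := FiniteDimensional.proper ℝ _
  have hK : IsCompact (closure (Pcone V) ∩ Metric.sphere (0 : Mat r n) 1) :=
    (isCompact_sphere _ _).inter_left isClosed_closure
  have hcont : Continuous fun z : ℝ × Mat r n => tip (θ + z.1 • α) z.2 :=
    tip_continuous.comp (Continuous.prodMk (by fun_prop) continuous_snd)
  have key := hK.eventually_forall_of_forall_eventually (x₀ := (0 : ℝ))
    (P := fun u x => 0 < tip (θ + u • α) x) fun x hx => by
      refine hcont.continuousAt.eventually (lt_mem_nhds ?_)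
      simpa using hθ.2 x hx.1 (by rintro rfl; simpa using hx.2)
  filter_upwards [key] with u hu
  refine ⟨(Zsub V).add_mem hθ.1 ((Zsub V).smul_mem u hα), fun x hx hx0 => ?_⟩
  have hn : 0 < ‖x‖ := norm_pos_iff.2 hx0
  have := hu (‖x‖⁻¹ • x) ⟨smul_mem_closure_Pcone hx (inv_pos.2 hn), by
    simp [norm_smul, hn.ne']⟩
  rw [tip_smul_right] at this
  exact (pos_iff_pos_of_mul_pos this).1 (inv_pos.2 hn)

end Cones

section Moments

variable {Ω : Type*} [MeasurableSpace Ω]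

lemma pow_mul_exp_half_le {ε y : ℝ} (hε : 0 < ε) (hy : 0 ≤ y) :
    (1 + y + y ^ 2) * Real.exp (ε / 2 * y)
      ≤ (1 + 2 / ε + 8 / ε ^ 2) * Real.exp (ε * y) := by
  have hz : 0 ≤ ε / 2 * y := by positivity
  have h := Real.quadratic_le_exp_of_nonneg hz
  have e : Real.exp (ε * y) = Real.exp (ε / 2 * y) * Real.exp (ε / 2 * y) := by
    rw [← Real.exp_add]
    ring_nf
  have h1 : 1 ≤ Real.exp (ε / 2 * y) := by nlinarith
  have h2 : y ≤ 2 / ε * Real.exp (ε / 2 * y) := by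
    rw [div_mul_eq_mul_div, le_div_iff₀ hε]
    nlinarith
  have h3 : y ^ 2 ≤ 8 / ε ^ 2 * Real.exp (ε / 2 * y) := by
    rw [div_mul_eq_mul_div, le_div_iff₀ (by positivity)]
    nlinarith
  rw [e, ← mul_assoc]
  refine mul_le_mul_of_nonneg_right ?_ (Real.exp_pos _).le
  linarith

lemma integrable_mul_exp_neg {μ : Measure Ω} {a f y : Ω → ℝ} {ε : ℝ} (hε : 0 < ε)
    (ha : Measurable a) (hf : Measurable f) (hy : ∀ x, 0 ≤ y x)
    (hfy : ∀ x, |f x| ≤ 1 + y x + y x ^ 2)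
    (hinteg : Integrable (fun x => Real.exp (-a x + ε * y x)) μ) :
    Integrable (fun x => f x * Real.exp (-a x)) μ := by
  refine (hinteg.const_mul (1 + 2 / ε + 8 / ε ^ 2)).mono' (by fun_prop) (ae_of_all _ fun x => ?_)
  rw [Real.norm_eq_abs, abs_mul, Real.abs_exp, Real.exp_add]
  have h1 : 1 ≤ Real.exp (ε / 2 * y x) :=
    Real.one_le_exp (by have := hy x; positivity)
  have h0 : 0 ≤ 1 + y x + y x ^ 2 := by have := hy x; positivity
  calc |f x| * Real.exp (-a x) ≤ (1 + y x + y x ^ 2) * Real.exp (ε / 2 * y x) * Real.exp (-a x) := by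
        refine mul_le_mul_of_nonneg_right ((hfy x).trans ?_) (Real.exp_pos _).le
        nlinarith
    _ ≤ _ := by
        have := mul_le_mul_of_nonneg_right (pow_mul_exp_half_le hε (hy x)) (Real.exp_pos (-a x)).le
        linarith

open Topology in
/-- First and second derivatives of `u ↦ ∫ exp (-(a + u b + u² c))` at `0`, computed by
differentiation under the integral sign. -/
lemma moments_of_curve {μ : Measure Ω} {a b c : Ω → ℝ} {ε : ℝ} (hε : 0 < ε)
    (ha : Measurable a) (hb : Measurable b) (hc : Measurable c)
    (hinteg : Integrable (fun x => Real.exp (-a x + ε * (|b x| + |c x|))) μ)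
    {G G₁ : ℝ → ℝ} {G₂ : ℝ}
    (hG : ∀ᶠ u in 𝓝 0, ∫ x, Real.exp (-(a x + u * b x + u ^ 2 * c x)) ∂μ = G u)
    (hG₁ : ∀ᶠ u in 𝓝 0, HasDerivAt G (G₁ u) u) (hG₂ : HasDerivAt G₁ G₂ 0) :
    ∫ x, b x * Real.exp (-a x) ∂μ = -G₁ 0 ∧
      ∫ x, (b x ^ 2 - 2 * c x) * Real.exp (-a x) ∂μ = G₂ := by
  set F : ℝ → Ω → ℝ := fun u x => Real.exp (-(a x + u * b x + u ^ 2 * c x)) with hF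
  set F₁ : ℝ → Ω → ℝ := fun u x => -(b x + 2 * u * c x) * F u x with hF₁
  set F₂ : ℝ → Ω → ℝ := fun u x => ((b x + 2 * u * c x) ^ 2 - 2 * c x) * F u x with hF₂
  set δ : ℝ := min (ε / 2) (1 / 2) with hδ
  have hδ0 : 0 < δ := by positivity
  set bound : Ω → ℝ := fun x => 2 * ((1 + 2 / ε + 8 / ε ^ 2) *
    Real.exp (-a x + ε * (|b x| + |c x|))) with hbound
  have hbi : Integrable bound μ := (hinteg.const_mul _).const_mul _
  have mF : ∀ u, AEStronglyMeasurable (F u) μ := fun u => by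
    apply Measurable.aestronglyMeasurable
    fun_prop
  have mF₁ : ∀ u, AEStronglyMeasurable (F₁ u) μ := fun u => by
    apply Measurable.aestronglyMeasurable
    fun_prop
  have mF₂ : ∀ u, AEStronglyMeasurable (F₂ u) μ := fun u => by
    apply Measurable.aestronglyMeasurable
    fun_prop
  have main : ∀ u ∈ Metric.ball (0 : ℝ) δ, ∀ x (f : ℝ),
      |f| ≤ 2 * (1 + (|b x| + |c x|) + (|b x| + |c x|) ^ 2) → ‖f * F u x‖ ≤ bound x := by
    intro u hu x f hf
    have hu' : |u| < δ := by simpa using hu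
    have hu1 : |u| ≤ 1 / 2 := hu'.le.trans (min_le_right _ _)
    have hu2 : |u| ≤ ε / 2 := hu'.le.trans (min_le_left _ _)
    have hexp : F u x ≤ Real.exp (-a x) * Real.exp (ε / 2 * (|b x| + |c x|)) := by
      rw [hF, ← Real.exp_add]
      refine Real.exp_le_exp.2 ?_
      have h1 : -(u * b x) ≤ ε / 2 * |b x| := by
        refine (neg_le_abs _).trans ?_
        rw [abs_mul]
        exact mul_le_mul_of_nonneg_right hu2 (abs_nonneg _)
      have h2 : -(u ^ 2 * c x) ≤ ε / 2 * |c x| := by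
        refine (neg_le_abs _).trans ?_
        rw [abs_mul]
        refine mul_le_mul_of_nonneg_right ?_ (abs_nonneg _)
        rw [abs_pow]
        nlinarith [abs_nonneg u]
      linarith
    have hM : 0 ≤ |b x| + |c x| := by positivity
    rw [Real.norm_eq_abs, abs_mul, Real.abs_exp]
    calc |f| * F u x ≤ 2 * (1 + (|b x| + |c x|) + (|b x| + |c x|) ^ 2) *
          (Real.exp (-a x) * Real.exp (ε / 2 * (|b x| + |c x|))) :=
          mul_le_mul hf hexp (Real.exp_pos _).le (by positivity)
      _ = 2 * (Real.exp (-a x) * ((1 + (|b x| + |c x|) + (|b x| + |c x|) ^ 2) *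
          Real.exp (ε / 2 * (|b x| + |c x|)))) := by ring
      _ ≤ 2 * (Real.exp (-a x) * ((1 + 2 / ε + 8 / ε ^ 2) *
          Real.exp (ε * (|b x| + |c x|)))) := by
          have := pow_mul_exp_half_le hε hM
          gcongr
      _ = bound x := by
          simp only [hbound, Real.exp_add]
          ring
  have hlin : ∀ u ∈ Metric.ball (0 : ℝ) δ, ∀ x, |b x + 2 * u * c x| ≤ |b x| + |c x| := by
    intro u hu x
    have hu' : |u| < δ := by simpa using hu
    have hu1 : |u| ≤ 1 / 2 := hu'.le.trans (min_le_right _ _)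
    refine (abs_add_le _ _).trans ?_
    rw [abs_mul, abs_mul, abs_two]
    nlinarith [abs_nonneg (c x)]
  have bF₁ : ∀ u ∈ Metric.ball (0 : ℝ) δ, ∀ x, ‖F₁ u x‖ ≤ bound x := by
    intro u hu x
    refine main u hu x _ ?_
    rw [abs_neg]
    nlinarith [hlin u hu x, abs_nonneg (b x), abs_nonneg (c x), sq_nonneg (|b x| + |c x|)]
  have bF₂ : ∀ u ∈ Metric.ball (0 : ℝ) δ, ∀ x, ‖F₂ u x‖ ≤ bound x := by
    intro u hu x
    refine main u hu x _ ?_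
    refine (abs_sub _ _).trans ?_
    rw [abs_pow, abs_mul, abs_two]
    have := pow_le_pow_left₀ (abs_nonneg _) (hlin u hu x) 2
    nlinarith [abs_nonneg (b x), abs_nonneg (c x), sq_nonneg (|b x| + |c x|)]
  have bF : ∀ u ∈ Metric.ball (0 : ℝ) δ, ∀ x, ‖F u x‖ ≤ bound x := by
    intro u hu x
    have := main u hu x 1 (by
      rw [abs_one]
      nlinarith [abs_nonneg (b x), abs_nonneg (c x), sq_nonneg (|b x| + |c x|)])
    rwa [one_mul] at this
  have dP : ∀ u x, HasDerivAt (fun u => -(a x + u * b x + u ^ 2 * c x))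
      (-(b x + 2 * u * c x)) u := fun u x => by
    have h1 := ((hasDerivAt_id u).mul_const (b x)).const_add (a x)
    have h2 := ((hasDerivAt_id u).pow 2).mul_const (c x)
    exact (h1.add h2).neg.congr_deriv (by simp)
  have dF : ∀ u x, HasDerivAt (fun u => F u x) (F₁ u x) u := fun u x => by
    exact (dP u x).exp.congr_deriv (mul_comm _ _)
  have dF₁ : ∀ u x, HasDerivAt (fun u => F₁ u x) (F₂ u x) u := fun u x => by
    have h1 : HasDerivAt (fun u => -(b x + 2 * u * c x)) (-(2 * c x)) u := by
      have := ((((hasDerivAt_id u).const_mul 2).mul_const (c x)).const_add (b x)).neg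
      exact this.congr_deriv (by simp)
    refine (h1.mul (dF u x)).congr_deriv ?_
    simp only [hF₁, hF₂]
    ring
  have I₁ : ∀ u ∈ Metric.ball (0 : ℝ) δ,
      HasDerivAt (fun u => ∫ x, F u x ∂μ) (∫ x, F₁ u x ∂μ) u := fun u hu =>
    (hasDerivAt_integral_of_dominated_loc_of_deriv_le (Metric.isOpen_ball.mem_nhds hu)
      (Filter.Eventually.of_forall mF) (hbi.mono' (mF u) (ae_of_all _ (bF u hu))) (mF₁ u)
      (ae_of_all _ fun x v hv => bF₁ v hv x) hbi (ae_of_all _ fun x v _ => dF v x)).2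
  have hball : ∀ᶠ u in 𝓝 (0 : ℝ), u ∈ Metric.ball (0 : ℝ) δ := Metric.ball_mem_nhds _ hδ0
  have h0 := Metric.mem_ball_self hδ0 (x := (0 : ℝ))
  have I₂ : HasDerivAt (fun u => ∫ x, F₁ u x ∂μ) (∫ x, F₂ 0 x ∂μ) 0 :=
    (hasDerivAt_integral_of_dominated_loc_of_deriv_le (Metric.ball_mem_nhds _ hδ0)
      (Filter.Eventually.of_forall mF₁) (hbi.mono' (mF₁ 0) (ae_of_all _ (bF₁ 0 h0))) (mF₂ 0)
      (ae_of_all _ fun x v hv => bF₂ v hv x) hbi (ae_of_all _ fun x v _ => dF₁ v x)).2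
  have E₁ : (fun u => ∫ x, F₁ u x ∂μ) =ᶠ[𝓝 0] G₁ := by
    filter_upwards [hball, hG.eventually_nhds, hG₁] with u hu hGu hG₁u
    exact (I₁ u hu).unique (hG₁u.congr_of_eventuallyEq hGu)
  constructor
  · rw [← E₁.eq_of_nhds, ← integral_neg]
    simp [hF₁, hF]
  · rw [← I₂.unique (hG₂.congr_of_eventuallyEq E₁)]
    simp [hF₂, hF]

/-- If two members of an exponential family have the same mean in the direction `d`, then the
statistic `d` is almost surely constant. -/
lemma ae_eq_zero_of_tilted_means {μ : Measure Ω} {f g u : Ω → ℝ} {c : ℝ}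
    (hfg : ∀ x, g x = f x + (u x + c))
    (hf : Integrable (fun x => Real.exp (f x)) μ) (hg : Integrable (fun x => Real.exp (g x)) μ)
    (hfu : Integrable (fun x => u x * Real.exp (f x)) μ)
    (hgu : Integrable (fun x => u x * Real.exp (g x)) μ)
    (hf0 : ∫ x, u x * Real.exp (f x) ∂μ = 0) (hg0 : ∫ x, u x * Real.exp (g x) ∂μ = 0) :
    ∀ᵐ x ∂μ, u x = 0 := by
  have h1 : ∫ x, Real.exp (g x) * Real.exp (-c) ∂μ ≤ ∫ x, Real.exp (f x) ∂μ := by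
    have : ∫ x, (Real.exp (g x) - u x * Real.exp (g x)) * Real.exp (-c) ∂μ ≤
        ∫ x, Real.exp (f x) ∂μ := by
      refine integral_mono ((hg.sub hgu).mul_const _) hf fun x => ?_
      have h := Real.add_one_le_exp (-u x)
      have e : Real.exp (f x) = Real.exp (g x) * Real.exp (-c) * Real.exp (-u x) := by
        rw [hfg x, ← Real.exp_add, ← Real.exp_add]
        ring_nf
      have hp : 0 ≤ Real.exp (g x) * Real.exp (-c) := by positivity
      simp only [e]
      nlinarith
    rw [integral_mul_const, integral_sub hg hgu, hg0, sub_zero] at this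
    rwa [integral_mul_const]
  have hi : Integrable (fun x => Real.exp (g x) * Real.exp (-c) -
      (Real.exp (f x) + u x * Real.exp (f x))) μ := (hg.mul_const _).sub (hf.add hfu)
  have hx : ∀ x, Real.exp (g x) * Real.exp (-c) - (Real.exp (f x) + u x * Real.exp (f x)) =
      Real.exp (f x) * (Real.exp (u x) - (u x + 1)) := fun x => by
    have e : Real.exp (g x) * Real.exp (-c) = Real.exp (f x) * Real.exp (u x) := by
      rw [hfg x, ← Real.exp_add, ← Real.exp_add]
      ring_nf
    rw [e]
    ring
  have hnn : ∀ x, 0 ≤ Real.exp (g x) * Real.exp (-c) -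
      (Real.exp (f x) + u x * Real.exp (f x)) := fun x => by
    rw [hx]
    exact mul_nonneg (Real.exp_pos _).le (sub_nonneg.2 (Real.add_one_le_exp _))
  have hz : ∫ x, Real.exp (g x) * Real.exp (-c) -
      (Real.exp (f x) + u x * Real.exp (f x)) ∂μ = 0 := by
    refine le_antisymm ?_ (integral_nonneg hnn)
    have e := integral_sub (hg.mul_const (Real.exp (-c))) (hf.add hfu)
    simp only [Pi.add_apply] at e
    rw [e, integral_add hf hfu, hf0]
    linarith
  filter_upwards [(integral_eq_zero_iff_of_nonneg hnn hi).1 hz] with x hx'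
  by_contra hne
  have h2 : Real.exp (f x) * (Real.exp (u x) - (u x + 1)) = 0 := by rw [← hx x]; exact hx'
  exact (mul_pos (Real.exp_pos (f x)) (sub_pos.2 (Real.add_one_lt_exp hne))).ne' h2

end Moments

section ExponentialFamily

variable {V} {μ : Measure (Mat r n)}

lemma integrable_exp_neg_tip {θ : Mat r n} (h : laplace μ θ ≠ ⊤) :
    Integrable (fun x => Real.exp (-(tip θ x))) μ := by
  have hm : Measurable fun x => Real.exp (-(tip θ x)) := (tip_measurable θ).neg.exp
  refine ⟨hm.aestronglyMeasurable, ?_⟩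
  rw [hasFiniteIntegral_iff_ofReal (ae_of_all _ fun _ => (Real.exp_pos _).le)]
  exact h.lt_top

lemma laplaceR_eq_toReal (θ : Mat r n) : laplaceR μ θ = (laplace μ θ).toReal :=
  integral_eq_lintegral_of_nonneg_ae (ae_of_all _ fun _ => (Real.exp_pos _).le)
    (tip_measurable θ).neg.exp.aestronglyMeasurable

lemma exists_integrable_exp (hfin : ∀ θ ∈ Qcone V, laplace μ θ ≠ ⊤) {θ α β : Mat r n}
    (hθ : θ ∈ Qcone V) (hα : α ∈ Zspace V) (hβ : β ∈ Zspace V) :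
    ∃ ε > 0, Integrable (fun x => Real.exp (-tip θ x + ε * (|tip α x| + |tip β x|))) μ := by
  obtain ⟨δ, hδ, h⟩ := Metric.eventually_nhds_iff.1
    ((eventually_add_smul_mem_Qcone hθ ((Zsub V).add_mem hα hβ)).and
      (eventually_add_smul_mem_Qcone hθ ((Zsub V).sub_mem hα hβ)))
  have h1 := h (y := δ / 2) (by rw [dist_zero_right, Real.norm_eq_abs, abs_of_pos] <;> linarith)
  have h2 := h (y := -(δ / 2))
    (by rw [dist_zero_right, norm_neg, Real.norm_eq_abs, abs_of_pos] <;> linarith)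
  refine ⟨δ / 2, by positivity, ?_⟩
  have hi := (((integrable_exp_neg_tip (hfin _ h1.1)).add
    (integrable_exp_neg_tip (hfin _ h1.2))).add (integrable_exp_neg_tip (hfin _ h2.1))).add
    (integrable_exp_neg_tip (hfin _ h2.2))
  refine hi.mono' ?_ (ae_of_all _ fun x => ?_)
  · have mθ := tip_measurable θ
    have mα := tip_measurable α
    have mβ := tip_measurable β
    apply Measurable.aestronglyMeasurable
    fun_prop
  · simp only [Pi.add_apply, tip_add_left, tip_sub_left, tip_smul_left, Real.norm_eq_abs,
      Real.abs_exp]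
    generalize tip θ x = t
    generalize tip α x = a
    generalize tip β x = b
    have e1 := Real.exp_pos (-(t + δ / 2 * (a + b)))
    have e2 := Real.exp_pos (-(t + δ / 2 * (a - b)))
    have e3 := Real.exp_pos (-(t + -(δ / 2) * (a + b)))
    have e4 := Real.exp_pos (-(t + -(δ / 2) * (a - b)))
    rcases abs_cases a with ⟨ha, _⟩ | ⟨ha, _⟩ <;> rcases abs_cases b with ⟨hb, _⟩ | ⟨hb, _⟩ <;>
      rw [ha, hb]
    · rw [show -t + δ / 2 * (a + b) = -(t + -(δ / 2) * (a + b)) by ring]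
      linarith
    · rw [show -t + δ / 2 * (a + -b) = -(t + -(δ / 2) * (a - b)) by ring]
      linarith
    · rw [show -t + δ / 2 * (-a + b) = -(t + δ / 2 * (a - b)) by ring]
      linarith
    · rw [show -t + δ / 2 * (-a + -b) = -(t + δ / 2 * (a + b)) by ring]
      linarith

lemma integrable_tip_mul_exp (hfin : ∀ θ ∈ Qcone V, laplace μ θ ≠ ⊤) {θ α : Mat r n}
    (hθ : θ ∈ Qcone V) (hα : α ∈ Zspace V) :
    Integrable (fun x => tip α x * Real.exp (-tip θ x)) μ := by
  obtain ⟨ε, hε, h⟩ := exists_integrable_exp hfin hθ hα hα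
  refine integrable_mul_exp_neg hε (tip_measurable θ) (tip_measurable α)
    (fun _ => by positivity) (fun x => ?_) h
  nlinarith [abs_nonneg (tip α x)]

lemma integrable_tip_mul_tip_mul_exp (hfin : ∀ θ ∈ Qcone V, laplace μ θ ≠ ⊤) {θ α β : Mat r n}
    (hθ : θ ∈ Qcone V) (hα : α ∈ Zspace V) (hβ : β ∈ Zspace V) :
    Integrable (fun x => tip α x * tip β x * Real.exp (-tip θ x)) μ := by
  obtain ⟨ε, hε, h⟩ := exists_integrable_exp hfin hθ hα hβ
  refine integrable_mul_exp_neg hε (tip_measurable θ) ((tip_measurable α).mul (tip_measurable β))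
    (fun _ => by positivity) (fun x => ?_) h
  rw [abs_mul]
  nlinarith [abs_nonneg (tip α x), abs_nonneg (tip β x)]

lemma integrable_tip_sub_mul_exp (hfin : ∀ θ ∈ Qcone V, laplace μ θ ≠ ⊤) {θ α : Mat r n}
    (m : Mat r n) (hθ : θ ∈ Qcone V) (hα : α ∈ Zspace V) :
    Integrable (fun x => tip α (x - m) * Real.exp (-tip θ x)) μ := by
  have h := (integrable_tip_mul_exp hfin hθ hα).sub
    ((integrable_exp_neg_tip (hfin θ hθ)).const_mul (tip α m))
  refine h.congr (ae_of_all _ fun x => ?_)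
  simp only [Pi.sub_apply, tip_sub_right]
  ring

lemma integrable_cov (hfin : ∀ θ ∈ Qcone V, laplace μ θ ≠ ⊤) {θ α β : Mat r n}
    (m : Mat r n) (hθ : θ ∈ Qcone V) (hα : α ∈ Zspace V) (hβ : β ∈ Zspace V) :
    Integrable (fun x => Real.exp (-tip θ x) * tip α (x - m) * tip β (x - m)) μ := by
  have h := (integrable_tip_mul_tip_mul_exp hfin hθ hα hβ).sub
    (((integrable_tip_mul_exp hfin hθ hα).const_mul (tip β m)).add
      ((integrable_tip_sub_mul_exp hfin m hθ hβ).const_mul (tip α m)))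
  refine h.congr (ae_of_all _ fun x => ?_)
  simp only [Pi.sub_apply, Pi.add_apply, tip_sub_right]
  ring

lemma exists_tip_eq_entry (V : ∀ l k : Fin (r + 1), Submodule ℝ (Matrix (Fin (n l)) (Fin (n k)) ℝ))
    (p q : Idx r n) : ∃ e ∈ Zspace V, ∀ x ∈ Zspace V, tip e x = x p q :=
  exists_tip_eq V (Matrix.entryLinearMap ℝ ℝ p q)

lemma integral_tip_of_meanMap (hsupp : ∀ᵐ x ∂μ, x ∈ Zspace V)
    (hfin : ∀ θ ∈ Qcone V, laplace μ θ ≠ ⊤) {θ m : Mat r n} (hθ : θ ∈ Qcone V)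
    (hL : laplaceR μ θ ≠ 0) (hm : meanMap μ θ = m) (α : Mat r n) :
    ∫ x, tip α x * Real.exp (-tip θ x) ∂μ = laplaceR μ θ * tip α m := by
  have hentry : ∀ p q, ∫ x, Real.exp (-(tip θ x)) * x p q ∂μ = laplaceR μ θ * m p q := by
    intro p q
    rw [← hm, meanMap, Matrix.of_apply, mul_inv_cancel_left₀ hL]
  have hinteg : ∀ p q, Integrable (fun x : Mat r n => Real.exp (-(tip θ x)) * x p q) μ := by
    intro p q
    obtain ⟨e, he, hx⟩ := exists_tip_eq_entry V p q
    refine (integrable_tip_mul_exp hfin hθ he).congr ?_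
    filter_upwards [hsupp] with x hxZ
    rw [hx x hxZ, mul_comm]
  have e1 : ∀ x : Mat r n, tip α x * Real.exp (-tip θ x) =
      ∑ p, ∑ q, α p q * (Real.exp (-(tip θ x)) * x q p) := fun x => by
    rw [tip_eq_sum α, Finset.sum_mul]
    refine Finset.sum_congr rfl fun p _ => ?_
    rw [Finset.sum_mul]
    exact Finset.sum_congr rfl fun q _ => by ring
  have swap : ∀ f : Idx r n → Idx r n → Mat r n → ℝ, (∀ p q, Integrable (f p q) μ) →
      ∫ x, ∑ p, ∑ q, f p q x ∂μ = ∑ p, ∑ q, ∫ x, f p q x ∂μ := fun f hf => by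
    rw [integral_finsetSum _ fun p _ => integrable_finsetSum _ fun q _ => hf p q]
    exact Finset.sum_congr rfl fun p _ => integral_finsetSum _ fun q _ => hf p q
  rw [integral_congr_ae (ae_of_all _ e1),
    swap (fun p q x => α p q * (Real.exp (-(tip θ x)) * x q p))
      fun p q => (hinteg q p).const_mul _, tip_eq_sum, Finset.mul_sum]
  refine Finset.sum_congr rfl fun p _ => ?_
  rw [Finset.mul_sum]
  refine Finset.sum_congr rfl fun q _ => ?_
  rw [integral_const_mul, hentry]
  ring

/-- The covariance operator depends on the parameter only through the mean. -/
lemma varOp_eq_of_mean_eq (hfin : ∀ θ ∈ Qcone V, laplace μ θ ≠ ⊤) {θ₁ θ₀ m : Mat r n}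
    (h₁ : θ₁ ∈ Qcone V) (h₀ : θ₀ ∈ Qcone V)
    (hm₁ : ∀ α ∈ Zspace V, ∫ x, tip α x * Real.exp (-tip θ₁ x) ∂μ = laplaceR μ θ₁ * tip α m)
    (hm₀ : ∀ α ∈ Zspace V, ∫ x, tip α x * Real.exp (-tip θ₀ x) ∂μ = laplaceR μ θ₀ * tip α m)
    (ξ : Mat r n) : varOp μ θ₁ m ξ = varOp μ θ₀ m ξ := by
  have hd : θ₁ - θ₀ ∈ Zspace V := (Zsub V).sub_mem h₁.1 h₀.1
  have center : ∀ θ ∈ Qcone V,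
      (∀ α ∈ Zspace V, ∫ x, tip α x * Real.exp (-tip θ x) ∂μ = laplaceR μ θ * tip α m) →
      ∫ x, tip (θ₁ - θ₀) (x - m) * Real.exp (-tip θ x) ∂μ = 0 := by
    intro θ hθ hmean
    have e : ∀ x, tip (θ₁ - θ₀) (x - m) * Real.exp (-tip θ x) =
        tip (θ₁ - θ₀) x * Real.exp (-tip θ x) - tip (θ₁ - θ₀) m * Real.exp (-tip θ x) :=
      fun x => by rw [tip_sub_right, sub_mul]
    simp_rw [e]
    rw [integral_sub (integrable_tip_mul_exp hfin hθ hd)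
      ((integrable_exp_neg_tip (hfin θ hθ)).const_mul _), integral_const_mul, hmean _ hd, laplaceR]
    ring
  have hu := ae_eq_zero_of_tilted_means (μ := μ) (f := fun x => -tip θ₁ x)
    (g := fun x => -tip θ₀ x) (u := fun x => tip (θ₁ - θ₀) (x - m)) (c := tip (θ₁ - θ₀) m)
    (fun x => by simp only [tip_sub_right, tip_sub_left]; ring)
    (integrable_exp_neg_tip (hfin _ h₁)) (integrable_exp_neg_tip (hfin _ h₀))
    (integrable_tip_sub_mul_exp hfin m h₁ hd) (integrable_tip_sub_mul_exp hfin m h₀ hd)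
    (center _ h₁ hm₁) (center _ h₀ hm₀)
  set K := Real.exp (-tip (θ₁ - θ₀) m) with hK
  have hexp : ∀ᵐ x ∂μ, Real.exp (-tip θ₁ x) = K * Real.exp (-tip θ₀ x) := by
    filter_upwards [hu] with x hx
    rw [hK, ← Real.exp_add]
    congr 1
    simp only [tip_sub_right, tip_sub_left] at hx ⊢
    linarith
  have hL : laplaceR μ θ₁ = K * laplaceR μ θ₀ := by
    rw [laplaceR, laplaceR, ← integral_const_mul]
    exact integral_congr_ae hexp
  ext p q
  simp only [varOp, Matrix.of_apply]
  have hI : ∫ x, Real.exp (-(tip θ₁ x)) * tip ξ (x - m) * ((x - m) p q) ∂μ =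
      K * ∫ x, Real.exp (-(tip θ₀ x)) * tip ξ (x - m) * ((x - m) p q) ∂μ := by
    rw [← integral_const_mul]
    refine integral_congr_ae ?_
    filter_upwards [hexp] with x hx
    rw [hx]
    ring
  have hK0 : K ≠ 0 := (Real.exp_pos _).ne'
  rw [hI, hL, mul_inv, mul_mul_mul_comm, inv_mul_cancel₀ hK0, one_mul]

end ExponentialFamily

section Curve

variable {V}

lemma trace_rhoM (A y : Mat r n) : (rhoM A y).trace = tip (Aᵀ * A) y := by
  rw [rhoM, tip, Matrix.mul_assoc, Matrix.trace_mul_comm, Matrix.mul_assoc, Matrix.trace_mul_comm,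
    Matrix.mul_assoc]

lemma rhoM_mul (A B x : Mat r n) : rhoM (A * B) x = rhoM A (rhoM B x) := by
  simp only [rhoM, Matrix.transpose_mul, Matrix.mul_assoc]

lemma tip_one_left (x : Mat r n) : tip 1 x = x.trace := by rw [tip, Matrix.one_mul]

/-- The diagonal matrix with diagonal blocks `(a k)^{-1/2} I`. -/
noncomputable def scaleDiag (a : Fin (r + 1) → ℝ) : Mat r n :=
  Matrix.diagonal fun p => √((a p.1)⁻¹)

lemma scaleDiag_mem_Hgrp {a : Fin (r + 1) → ℝ} (ha : ∀ k, 0 < a k) :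
    (scaleDiag a : Mat r n) ∈ Hgrp V := by
  have hoff : ∀ l k, l ≠ k → blk (scaleDiag a : Mat r n) l k = 0 := fun l k h => by
    ext i j
    simp [blk, scaleDiag, h]
  refine ⟨fun k l h => hoff l k h.ne, fun k l h => ?_, fun k => ⟨√((a k)⁻¹), ?_, fun i j => ?_⟩⟩
  · rw [hoff l k h.ne']
    exact (V l k).zero_mem
  · exact Real.sqrt_pos.2 (inv_pos.2 (ha k))
  · simp [scaleDiag, Matrix.diagonal_apply]

lemma transpose_scaleDiag_mul_self {a : Fin (r + 1) → ℝ} (ha : ∀ k, 0 < a k) :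
    (scaleDiag a : Mat r n)ᵀ * scaleDiag a = Matrix.diagonal fun p => (a p.1)⁻¹ := by
  rw [scaleDiag, Matrix.diagonal_transpose, Matrix.diagonal_mul_diagonal]
  congr 1
  funext p
  exact Real.mul_self_sqrt (inv_pos.2 (ha p.1)).le

lemma diagonal_mul_lowerPart_add {a : Fin (r + 1) → ℝ} (ha : ∀ k, 0 < a k) {ζ : Mat r n}
    (hζ : ζ.IsSymm) :
    Matrix.diagonal (fun p : Idx r n => (a p.1)⁻¹) * lowerPart a ζ +
      (lowerPart a ζ)ᵀ * Matrix.diagonal (fun p : Idx r n => (a p.1)⁻¹) = ζ := by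
  ext p q
  have hs : ζ q p = ζ p q := hζ.apply p q
  have hp := (ha p.1).ne'
  have hq := (ha q.1).ne'
  rw [Matrix.add_apply, Matrix.diagonal_mul, Matrix.mul_diagonal]
  simp only [Matrix.transpose_apply, lowerPart, Matrix.of_apply, hs]
  rcases lt_trichotomy p.1 q.1 with h | h | h
  · simp [h, h.le.not_gt, h.ne']
    field_simp
  · simp [h]
    field_simp
    ring
  · simp [h, h.le.not_gt, h.ne']
    field_simp

/-- Quadratic expansion of `⟨ρ*(D (1 + u B) S) I, x⟩` in `u`. -/
lemma trace_rhoM_curve {a : Fin (r + 1) → ℝ} (ha : ∀ k, 0 < a k) {ζ : Mat r n}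
    (hζ : ζ.IsSymm) (S x : Mat r n) (u : ℝ) :
    (rhoM (scaleDiag a * (1 + u • lowerPart a ζ) * S) x).trace =
      (rhoM (scaleDiag a * S) x).trace + u * tip ζ (rhoM S x) +
        u ^ 2 * (rhoM (scaleDiag a * lowerPart a ζ * S) x).trace := by
  have e : (scaleDiag a * (1 + u • lowerPart a ζ))ᵀ * (scaleDiag a * (1 + u • lowerPart a ζ)) =
      (scaleDiag a)ᵀ * scaleDiag a + u • ζ +
        u ^ 2 • ((scaleDiag a * lowerPart a ζ)ᵀ * (scaleDiag a * lowerPart a ζ)) := by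
    have hz := diagonal_mul_lowerPart_add ha hζ
    rw [← transpose_scaleDiag_mul_self ha] at hz
    generalize lowerPart a ζ = B at hz ⊢
    rw [← hz]
    simp only [Matrix.transpose_mul, Matrix.transpose_add, Matrix.transpose_smul, Matrix.mul_add,
      Matrix.add_mul, Matrix.mul_one, Matrix.mul_smul, Matrix.smul_mul, smul_add, smul_smul,
      pow_two, Matrix.mul_assoc]
    abel
  rw [rhoM_mul, rhoM_mul (scaleDiag a) S, rhoM_mul (scaleDiag a * lowerPart a ζ) S, trace_rhoM,
    trace_rhoM, trace_rhoM, e, tip_add_left, tip_add_left, tip_smul_left, tip_smul_left]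

lemma chi_curve {s : Fin (r + 1) → ℝ} {D B S : Mat r n} (hV1 : CondV1 V)
    (hD : D ∈ Hgrp V) (hB : B ∈ lowerAlg V) (hS : S ∈ Hgrp V) {u : ℝ}
    (hu : ∀ k, 0 < 1 + u * tdiag B k) :
    D * (1 + u • B) * S ∈ Hgrp V ∧
      chi (-s) (D * (1 + u • B) * S) =
        chi (-s) (D * S) * Real.exp (-∑ k, 2 * s k * Real.log (1 + u * tdiag B k)) := by
  obtain ⟨hD', hDp⟩ := mem_Hgrp_iff.1 hD
  obtain ⟨hS', hSp⟩ := mem_Hgrp_iff.1 hS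
  have hE : 1 + u • B ∈ lowerAlg V :=
    (lowerAlg V).add_mem one_mem_lowerAlg ((lowerAlg V).smul_mem u hB)
  have hEd : ∀ k, tdiag (1 + u • B) k = 1 + u * tdiag B k := fun k => by simp [tdiag]
  have hDE := mul_mem_lowerAlg hV1 hD' hE
  have htd : ∀ k, tdiag (D * (1 + u • B) * S) k =
      tdiag D k * tdiag S k * (1 + u * tdiag B k) := fun k => by
    rw [tdiag_mul hDE hS', tdiag_mul hD' hE, hEd]
    ring
  refine ⟨mem_Hgrp_iff.2 ⟨mul_mem_lowerAlg hV1 hDE hS', fun k => ?_⟩, ?_⟩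
  · rw [htd]
    exact mul_pos (mul_pos (hDp k) (hSp k)) (hu k)
  · rw [chi, chi, ← Finset.sum_neg_distrib, Real.exp_sum, ← Finset.prod_mul_distrib]
    refine Finset.prod_congr rfl fun k _ => ?_
    rw [htd, tdiag_mul hD' hS', Real.mul_rpow (mul_pos (hDp k) (hSp k)).le (hu k).le,
      Real.rpow_def_of_pos (hu k), Pi.neg_apply]
    ring_nf

lemma hasDerivAt_exp_neg_sum_log {ι : Type*} [Fintype ι] (s b : ι → ℝ) (C : ℝ) {u : ℝ}
    (hu : ∀ k, 0 < 1 + u * b k) :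
    HasDerivAt (fun u => C * Real.exp (-∑ k, 2 * s k * Real.log (1 + u * b k)))
      (C * Real.exp (-∑ k, 2 * s k * Real.log (1 + u * b k)) *
        -∑ k, 2 * s k * (b k / (1 + u * b k))) u := by
  have h : ∀ k, HasDerivAt (fun u => 2 * s k * Real.log (1 + u * b k))
      (2 * s k * (b k / (1 + u * b k))) u := fun k => by
    have h1 : HasDerivAt (fun u => 1 + u * b k) (b k) u := by
      simpa using ((hasDerivAt_id u).mul_const (b k)).const_add 1
    exact (h1.log (hu k).ne').const_mul _
  rw [mul_assoc]
  exact ((HasDerivAt.fun_sum fun k _ => h k).fun_neg.exp).const_mul C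

lemma hasDerivAt_deriv_exp_neg_sum_log {ι : Type*} [Fintype ι] (s b : ι → ℝ) (C : ℝ) :
    HasDerivAt (fun u => C * Real.exp (-∑ k, 2 * s k * Real.log (1 + u * b k)) *
        -∑ k, 2 * s k * (b k / (1 + u * b k)))
      (C * ((∑ k, 2 * s k * b k) ^ 2 + ∑ k, 2 * s k * b k ^ 2)) 0 := by
  have h1 := hasDerivAt_exp_neg_sum_log s b C (u := 0) (by simp)
  have h2 : ∀ k, HasDerivAt (fun u => 2 * s k * (b k / (1 + u * b k)))
      (2 * s k * -(b k ^ 2)) 0 := fun k => by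
    have h3 : HasDerivAt (fun u => 1 + u * b k) (b k) 0 := by
      simpa using ((hasDerivAt_id 0).mul_const (b k)).const_add 1
    have h4 := ((hasDerivAt_const (0 : ℝ) (b k)).fun_div h3 (by simp)).const_mul (2 * s k)
    refine h4.congr_deriv ?_
    simp only [zero_mul, add_zero, one_pow, div_one]
    ring
  refine (h1.fun_mul (HasDerivAt.fun_sum fun k _ => h2 k).fun_neg).congr_deriv ?_
  simp only [zero_mul, add_zero, div_one, Real.log_one, mul_zero, Finset.sum_const_zero, neg_zero,
    Real.exp_zero, mul_neg, Finset.sum_neg_distrib, neg_neg]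
  ring

lemma eventually_pos_one_add_mul {ι : Type*} [Finite ι] (b : ι → ℝ) :
    ∀ᶠ u in nhds (0 : ℝ), ∀ k, 0 < 1 + u * b k := by
  refine Filter.eventually_all.2 fun k => ?_
  have hc : Continuous fun u : ℝ => 1 + u * b k := by fun_prop
  exact hc.continuousAt.eventually (lt_mem_nhds (by simp))

lemma two_mul_sum_tdiag_lowerPart {a s : Fin (r + 1) → ℝ} (has : ∀ k, s k * a k = (n k : ℕ))
    {ζ : Mat r n} (hζ : ζ ∈ Zspace V) :
    ∑ k, 2 * s k * tdiag (lowerPart a ζ) k = ζ.trace := by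
  rw [Matrix.trace, Fintype.sum_sigma]
  refine Finset.sum_congr rfl fun k _ => ?_
  obtain ⟨c, hc⟩ := hζ.2.2 k
  simp only [Matrix.diag_apply, hc, if_true, Finset.sum_const, Finset.card_univ, Fintype.card_fin,
    nsmul_eq_mul, ← has k, tdiag, lowerPart, Matrix.of_apply, lt_irrefl, if_false]
  ring

/-- The quadratic form of the variance function, in terms of `ζ = ρ*(T) α`. -/
lemma sum_tdiag_sq_add_trace {a s : Fin (r + 1) → ℝ} (ha : ∀ k, 0 < a k)
    (has : ∀ k, s k * a k = (n k : ℕ)) {ζ : Mat r n} (hζ : ζ ∈ Zspace V) :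
    ∑ k, 2 * s k * tdiag (lowerPart a ζ) k ^ 2 +
        2 * (rhoM (scaleDiag a * lowerPart a ζ) 1).trace =
      ∑ p, ∑ q, a (max p.1 q.1) * (ζ p q * ζ q p) := by
  have hA : ∑ k, 2 * s k * tdiag (lowerPart a ζ) k ^ 2 =
      ∑ p : Idx r n, ∑ q : Idx r n, if q.1 = p.1 then a p.1 * ζ p q ^ 2 / 2 else 0 := by
    rw [Fintype.sum_sigma]
    refine Finset.sum_congr rfl fun k _ => ?_
    obtain ⟨c, hc⟩ := hζ.2.2 k
    have hrow : ∀ i : Fin (n k), (∑ q : Idx r n,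
        if q.1 = k then a k * ζ ⟨k, i⟩ q ^ 2 / 2 else 0) = a k * c ^ 2 / 2 := fun i => by
      rw [Fintype.sum_sigma, Finset.sum_eq_single k]
      · simp [hc, ite_pow, ← Finset.sum_div]
      · intro l _ hl
        simp [hl]
      · simp
    simp only [hrow, Finset.sum_const, Finset.card_univ, Fintype.card_fin, nsmul_eq_mul, ← has k,
      tdiag, lowerPart, Matrix.of_apply, lt_irrefl, if_false, if_true, hc]
    ring
  have hB : (rhoM (scaleDiag a * lowerPart a ζ) 1).trace =
      ∑ p : Idx r n, ∑ q : Idx r n, if q.1 < p.1 then a p.1 * ζ p q ^ 2 else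
        if q.1 = p.1 then a p.1 * ζ p q ^ 2 / 4 else 0 := by
    rw [rhoM, Matrix.mul_one, Matrix.trace]
    refine Finset.sum_congr rfl fun p _ => ?_
    rw [Matrix.diag_apply, Matrix.mul_apply]
    refine Finset.sum_congr rfl fun q _ => ?_
    have hp := (ha p.1).ne'
    have hsq : √((a p.1)⁻¹) * √((a p.1)⁻¹) = (a p.1)⁻¹ :=
      Real.mul_self_sqrt (inv_pos.2 (ha p.1)).le
    rw [Matrix.transpose_apply, scaleDiag, Matrix.diagonal_mul, mul_mul_mul_comm, hsq, lowerPart,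
      Matrix.of_apply]
    split_ifs
    · field_simp
    · field_simp
      norm_num
    · simp
  have hC : ∑ p : Idx r n, ∑ q : Idx r n, a (max p.1 q.1) * (ζ p q * ζ q p) =
      (∑ p : Idx r n, ∑ q : Idx r n, if q.1 < p.1 then a p.1 * ζ p q ^ 2 else 0) +
      (∑ p : Idx r n, ∑ q : Idx r n, if p.1 < q.1 then a q.1 * ζ q p ^ 2 else 0) +
      ∑ p : Idx r n, ∑ q : Idx r n, if q.1 = p.1 then a p.1 * ζ p q ^ 2 else 0 := by
    simp only [← Finset.sum_add_distrib]
    refine Finset.sum_congr rfl fun p _ => Finset.sum_congr rfl fun q _ => ?_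
    have hs : ζ q p = ζ p q := hζ.1.apply p q
    rw [hs]
    rcases lt_trichotomy p.1 q.1 with h | h | h
    · simp only [h, h.le.not_gt, h.ne', if_true, if_false, max_eq_right h.le]
      ring
    · simp only [h, lt_irrefl, max_self, if_true, if_false]
      ring
    · simp only [h, h.le.not_gt, h.ne, if_true, if_false, max_eq_left h.le]
      ring
  have hD : (∑ p : Idx r n, ∑ q : Idx r n, if p.1 < q.1 then a q.1 * ζ q p ^ 2 else 0) =
      ∑ p : Idx r n, ∑ q : Idx r n, if q.1 < p.1 then a p.1 * ζ p q ^ 2 else 0 :=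
    Finset.sum_comm
  rw [hC, hD, hA, hB, Finset.mul_sum]
  simp only [Finset.mul_sum, ← Finset.sum_add_distrib]
  refine Finset.sum_congr rfl fun p _ => Finset.sum_congr rfl fun q _ => ?_
  rcases lt_trichotomy p.1 q.1 with h | h | h
  · simp [h.le.not_gt, h.ne']
  · simp [h]
    ring
  · simp [h, h.ne]
    ring

lemma sum_telescope {r : ℕ} (a : Fin (r + 1) → ℝ) (k : Fin (r + 1)) :
    a (Fin.last r) + ∑ j : Fin r, (a j.castSucc - a j.succ) * (if k ≤ j.castSucc then 1 else 0) =
      a k := by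
  induction k using Fin.reverseInduction with
  | last => simp [Fin.last_le_iff, (Fin.castSucc_lt_last _).ne]
  | cast i ih =>
    have h : ∀ j : Fin r, (a j.castSucc - a j.succ) * (if i.castSucc ≤ j.castSucc then 1 else 0) =
        (a j.castSucc - a j.succ) * (if i.succ ≤ j.castSucc then 1 else 0) +
          if j = i then a j.castSucc - a j.succ else 0 := fun j => by
      rcases lt_trichotomy i j with h | rfl | h
      · simp [Fin.succ_le_castSucc_iff, h, h.le, h.ne']
      · simp [Fin.succ_le_castSucc_iff]
      · simp [Fin.succ_le_castSucc_iff, h.not_ge, h.le.not_gt, h.ne]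
    simp only [h, Finset.sum_add_distrib, Finset.sum_ite_eq', Finset.mem_univ, if_true]
    linarith

lemma Jmat_eq_diagonal (k : Fin (r + 1)) :
    (Jmat k : Mat r n) = Matrix.diagonal fun p => if p.1 ≤ k then 1 else 0 := by
  ext p q
  by_cases hpq : p = q
  · subst hpq
    simp [Jmat, pad]
  · simp [Jmat, pad, Matrix.one_apply, hpq]

lemma Jmat_mem_lowerAlg (k : Fin (r + 1)) : (Jmat k : Mat r n) ∈ lowerAlg V := by
  have hoff : ∀ l j, l ≠ j → blk (Jmat k : Mat r n) l j = 0 := fun l j h => by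
    ext p q
    simp [blk, Jmat_eq_diagonal, h]
  refine ⟨fun j l h => hoff l j h.ne, fun j l h => ?_,
    fun j => ⟨if j ≤ k then 1 else 0, blk_eq_smul_one_iff.2 fun p q => ?_⟩⟩
  · rw [hoff l j h.ne']
    exact (V l j).zero_mem
  · simp [Jmat_eq_diagonal, Matrix.diagonal_apply]

lemma tip_rhoM_Jmat (k : Fin (r + 1)) (x y : Mat r n) :
    tip x (rhoM (Jmat k) y) = ∑ p, ∑ q, (if max p.1 q.1 ≤ k then 1 else 0) * (x p q * y q p) := by
  rw [tip_eq_sum]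
  refine Finset.sum_congr rfl fun p _ => Finset.sum_congr rfl fun q _ => ?_
  rw [rhoM, Jmat_eq_diagonal, Matrix.diagonal_transpose, Matrix.mul_diagonal, Matrix.diagonal_mul]
  by_cases hp : p.1 ≤ k <;> by_cases hq : q.1 ≤ k <;> simp [hp, hq]

lemma tip_telescope (a : Fin (r + 1) → ℝ) (x y : Mat r n) :
    a (Fin.last r) * tip x y + ∑ j : Fin r, (a j.castSucc - a j.succ) *
        tip x (rhoM (Jmat j.castSucc) y) =
      ∑ p, ∑ q, a (max p.1 q.1) * (x p q * y q p) := by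
  simp only [tip_rhoM_Jmat, Finset.mul_sum]
  rw [Finset.sum_comm, tip_eq_sum, Finset.mul_sum, ← Finset.sum_add_distrib]
  refine Finset.sum_congr rfl fun p _ => ?_
  rw [Finset.sum_comm, Finset.mul_sum, ← Finset.sum_add_distrib]
  refine Finset.sum_congr rfl fun q _ => ?_
  rw [← sum_telescope a (max p.1 q.1), add_mul, Finset.sum_mul]
  congr 1
  exact Finset.sum_congr rfl fun j _ => by ring

end Curve

section Riesz

variable {V} {μ : Measure (Mat r n)} {a s : Fin (r + 1) → ℝ} {T θ₀ : Mat r n}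

lemma rhoM_mul_inv_cancel (hT : T ∈ Hgrp V) (x : Mat r n) : rhoM T (rhoM T⁻¹ x) = x := by
  rw [← rhoM_mul, Matrix.mul_nonsing_inv _ (det_pos_of_mem_Hgrp hT).ne'.isUnit, rhoM,
    Matrix.one_mul, Matrix.transpose_one, Matrix.mul_one]

lemma rhoM_inv_mul_cancel (hT : T ∈ Hgrp V) (x : Mat r n) : rhoM T⁻¹ (rhoM T x) = x := by
  rw [← rhoM_mul, Matrix.nonsing_inv_mul _ (det_pos_of_mem_Hgrp hT).ne'.isUnit, rhoM,
    Matrix.one_mul, Matrix.transpose_one, Matrix.mul_one]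

lemma exists_tip_eq_trace_rhoM
    (V : ∀ l k : Fin (r + 1), Submodule ℝ (Matrix (Fin (n l)) (Fin (n k)) ℝ)) (W : Mat r n) :
    ∃ β ∈ Zspace V, ∀ x ∈ Zspace V, tip β x = (rhoM W x).trace := by
  obtain ⟨β, hβ, h⟩ := exists_tip_eq V (tipForm (Wᵀ * W))
  exact ⟨β, hβ, fun x hx => by rw [h x hx, trace_rhoM, tipForm_apply]⟩

/-- First and second moments of the exponentially tilted Riesz measure along a quadratic curve. -/
lemma moments_riesz (hV1 : CondV1 V) (hV2 : CondV2 V) (hV3 : CondV3 V)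
    (hfin : ∀ θ ∈ Qcone V, laplace μ θ ≠ ⊤)
    (hLap : ∀ W ∈ Hgrp V, ∀ θ ∈ Zspace V, (∀ x ∈ Zspace V, tip θ x = (rhoM W x).trace) →
      laplaceR μ θ = chi (-s) W)
    (ha : ∀ k, 0 < a k) (has : ∀ k, s k * a k = (n k : ℕ)) (hT : T ∈ Hgrp V)
    (hθ₀ : θ₀ ∈ Qcone V) (h₀ : ∀ x ∈ Zspace V, tip θ₀ x = (rhoM (scaleDiag a * T⁻¹) x).trace)
    {α ζ β : Mat r n} (hα : α ∈ Zspace V) (hζ : ζ ∈ Zspace V) (hβ : β ∈ Zspace V)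
    (hζT : ∀ x ∈ Zspace V, tip ζ x = tip α (rhoM T x))
    (hβB : ∀ x ∈ Zspace V, tip β x = (rhoM (scaleDiag a * lowerPart a ζ * T⁻¹) x).trace) :
    ∫ x, tip α x * Real.exp (-tip θ₀ x) ∂μ = laplaceR μ θ₀ * tip α (rhoM T 1) ∧
      ∫ x, (tip α x ^ 2 - 2 * tip β x) * Real.exp (-tip θ₀ x) ∂μ = laplaceR μ θ₀ *
        (tip α (rhoM T 1) ^ 2 + ∑ k, 2 * s k * tdiag (lowerPart a ζ) k ^ 2) := by
  have hD : (scaleDiag a : Mat r n) ∈ Hgrp V := scaleDiag_mem_Hgrp ha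
  have hS := inv_mem_Hgrp hV1 hT
  have hB : lowerPart a ζ ∈ lowerAlg V := lowerPart_mem a hζ
  have hC : laplaceR μ θ₀ = chi (-s) (scaleDiag a * T⁻¹) := by
    refine hLap _ ?_ _ hθ₀.1 h₀
    simpa using (chi_curve (s := s) (u := 0) hV1 hD hB hS (by simp)).1
  have hsum : ∑ k, 2 * s k * tdiag (lowerPart a ζ) k = tip α (rhoM T 1) := by
    rw [two_mul_sum_tdiag_lowerPart has hζ, ← hζT 1 one_mem_Zspace, tip, Matrix.mul_one]
  obtain ⟨ε, hε, hinteg⟩ := exists_integrable_exp hfin hθ₀ hα hβ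
  have hcurve : ∀ᶠ u in nhds (0 : ℝ),
      ∫ x, Real.exp (-(tip θ₀ x + u * tip α x + u ^ 2 * tip β x)) ∂μ = laplaceR μ θ₀ *
        Real.exp (-∑ k, 2 * s k * Real.log (1 + u * tdiag (lowerPart a ζ) k)) := by
    filter_upwards [eventually_pos_one_add_mul fun k => tdiag (lowerPart a ζ) k] with u hu
    obtain ⟨hW, hchi⟩ := chi_curve (s := s) hV1 hD hB hS hu
    rw [hC, ← hchi, ← hLap _ hW (θ₀ + u • α + u ^ 2 • β)
      ((Zsub V).add_mem ((Zsub V).add_mem hθ₀.1 ((Zsub V).smul_mem _ hα))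
        ((Zsub V).smul_mem _ hβ)), laplaceR]
    · simp only [tip_add_left, tip_smul_left]
    · intro x hx
      rw [trace_rhoM_curve ha hζ.1, tip_add_left, tip_add_left, tip_smul_left, tip_smul_left,
        h₀ x hx, hβB x hx, hζT _ (rhoM_mem_Zspace hV1 hV2 hV3 (mem_Hgrp_iff.1 hS).1 hx),
        rhoM_mul_inv_cancel hT]
  have hderiv := (eventually_pos_one_add_mul fun k => tdiag (lowerPart a ζ) k).mono fun u hu =>
    hasDerivAt_exp_neg_sum_log s (fun k => tdiag (lowerPart a ζ) k) (laplaceR μ θ₀) hu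
  obtain ⟨m₁, m₂⟩ := moments_of_curve hε (tip_measurable θ₀) (tip_measurable α)
    (tip_measurable β) hinteg hcurve hderiv (hasDerivAt_deriv_exp_neg_sum_log s _ _)
  refine ⟨?_, ?_⟩
  · rw [m₁, ← hsum]
    simp
  · rw [m₂, hsum]

/-- The variance of `⟨α, ·⟩` under the exponentially tilted Riesz measure. -/
lemma integral_sq_riesz (hV1 : CondV1 V) (hV2 : CondV2 V) (hV3 : CondV3 V)
    (hfin : ∀ θ ∈ Qcone V, laplace μ θ ≠ ⊤)
    (hLap : ∀ W ∈ Hgrp V, ∀ θ ∈ Zspace V, (∀ x ∈ Zspace V, tip θ x = (rhoM W x).trace) →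
      laplaceR μ θ = chi (-s) W)
    (ha : ∀ k, 0 < a k) (has : ∀ k, s k * a k = (n k : ℕ)) (hT : T ∈ Hgrp V)
    (hθ₀ : θ₀ ∈ Qcone V) (h₀ : ∀ x ∈ Zspace V, tip θ₀ x = (rhoM (scaleDiag a * T⁻¹) x).trace)
    (hmean : ∀ α ∈ Zspace V,
      ∫ x, tip α x * Real.exp (-tip θ₀ x) ∂μ = laplaceR μ θ₀ * tip α (rhoM T 1))
    {α ζ : Mat r n} (hα : α ∈ Zspace V) (hζ : ζ ∈ Zspace V)
    (hζT : ∀ x ∈ Zspace V, tip ζ x = tip α (rhoM T x)) :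
    ∫ x, Real.exp (-tip θ₀ x) * tip α (x - rhoM T 1) * tip α (x - rhoM T 1) ∂μ =
      laplaceR μ θ₀ * ∑ p, ∑ q, a (max p.1 q.1) * (ζ p q * ζ q p) := by
  obtain ⟨β, hβ, hβB⟩ := exists_tip_eq_trace_rhoM V (scaleDiag a * lowerPart a ζ * T⁻¹)
  obtain ⟨-, h2⟩ := moments_riesz hV1 hV2 hV3 hfin hLap ha has hT hθ₀ h₀ hα hζ hβ hζT hβB
  have hβm : tip β (rhoM T 1) = (rhoM (scaleDiag a * lowerPart a ζ) 1).trace := by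
    rw [hβB _ (rhoM_one_mem_Pcone hV2 hV3 hT).1, rhoM_mul, rhoM_inv_mul_cancel hT]
  set m := rhoM T 1
  have iα := integrable_tip_mul_exp hfin hθ₀ hα
  have iβ := integrable_tip_mul_exp hfin hθ₀ hβ
  have iαα := integrable_tip_mul_tip_mul_exp hfin hθ₀ hα hα
  have i0 := integrable_exp_neg_tip (hfin θ₀ hθ₀)
  have i2 : Integrable (fun x => (tip α x ^ 2 - 2 * tip β x) * Real.exp (-tip θ₀ x)) μ := by
    refine (iαα.sub (iβ.const_mul 2)).congr (ae_of_all _ fun x => ?_)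
    simp only [Pi.sub_apply]
    ring
  have e : ∀ x, Real.exp (-tip θ₀ x) * tip α (x - m) * tip α (x - m) =
      ((tip α x ^ 2 - 2 * tip β x) * Real.exp (-tip θ₀ x) +
        2 * (tip β x * Real.exp (-tip θ₀ x))) +
      (-(2 * tip α m) * (tip α x * Real.exp (-tip θ₀ x)) +
        tip α m ^ 2 * Real.exp (-tip θ₀ x)) := fun x => by
    rw [tip_sub_right]
    ring
  simp_rw [e]
  rw [integral_add (i2.fun_add (iβ.const_mul _)) ((iα.const_mul _).fun_add (i0.const_mul _)),
    integral_add i2 (iβ.const_mul _), integral_add (iα.const_mul _) (i0.const_mul _),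
    integral_const_mul, integral_const_mul, integral_const_mul, h2, hmean α hα, hmean β hβ, hβm,
    ← sum_tdiag_sq_add_trace ha has hζ]
  have hI : ∫ x, Real.exp (-tip θ₀ x) ∂μ = laplaceR μ θ₀ := rfl
  rw [hI]
  ring

/-- The covariance of `⟨α, ·⟩` and `⟨β, ·⟩` under the exponentially tilted Riesz measure. -/
lemma integral_cov_riesz (hV1 : CondV1 V) (hV2 : CondV2 V) (hV3 : CondV3 V)
    (hfin : ∀ θ ∈ Qcone V, laplace μ θ ≠ ⊤)
    (hLap : ∀ W ∈ Hgrp V, ∀ θ ∈ Zspace V, (∀ x ∈ Zspace V, tip θ x = (rhoM W x).trace) →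
      laplaceR μ θ = chi (-s) W)
    (ha : ∀ k, 0 < a k) (has : ∀ k, s k * a k = (n k : ℕ)) (hT : T ∈ Hgrp V)
    (hθ₀ : θ₀ ∈ Qcone V) (h₀ : ∀ x ∈ Zspace V, tip θ₀ x = (rhoM (scaleDiag a * T⁻¹) x).trace)
    (hmean : ∀ α ∈ Zspace V,
      ∫ x, tip α x * Real.exp (-tip θ₀ x) ∂μ = laplaceR μ θ₀ * tip α (rhoM T 1))
    {α β ζ η : Mat r n} (hα : α ∈ Zspace V) (hβ : β ∈ Zspace V) (hζ : ζ ∈ Zspace V)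
    (hη : η ∈ Zspace V) (hζT : ∀ x ∈ Zspace V, tip ζ x = tip α (rhoM T x))
    (hηT : ∀ x ∈ Zspace V, tip η x = tip β (rhoM T x)) :
    ∫ x, Real.exp (-tip θ₀ x) * tip α (x - rhoM T 1) * tip β (x - rhoM T 1) ∂μ =
      laplaceR μ θ₀ * ∑ p, ∑ q, a (max p.1 q.1) * (η p q * ζ q p) := by
  have key : ∀ {α ζ : Mat r n}, α ∈ Zspace V → ζ ∈ Zspace V →
      (∀ x ∈ Zspace V, tip ζ x = tip α (rhoM T x)) → _ := fun hα hζ hζT =>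
    integral_sq_riesz hV1 hV2 hV3 hfin hLap ha has hT hθ₀ h₀ hmean hα hζ hζT
  have kα := key hα hζ hζT
  have kβ := key hβ hη hηT
  have ks := key ((Zsub V).add_mem hα hβ) ((Zsub V).add_mem hζ hη) fun x hx => by
    rw [tip_add_left, tip_add_left, hζT x hx, hηT x hx]
  set m := rhoM T 1
  have e : ∀ x, Real.exp (-tip θ₀ x) * tip (α + β) (x - m) * tip (α + β) (x - m) =
      Real.exp (-tip θ₀ x) * tip α (x - m) * tip α (x - m) +
        Real.exp (-tip θ₀ x) * tip β (x - m) * tip β (x - m) +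
      2 * (Real.exp (-tip θ₀ x) * tip α (x - m) * tip β (x - m)) := fun x => by
    rw [tip_add_left]
    ring
  have iαα := integrable_cov hfin m hθ₀ hα hα
  have iββ := integrable_cov hfin m hθ₀ hβ hβ
  have iαβ := integrable_cov hfin m hθ₀ hα hβ
  simp_rw [e] at ks
  rw [integral_add (iαα.fun_add iββ) (iαβ.const_mul 2), integral_add iαα iββ, integral_const_mul,
    kα, kβ] at ks
  have hsum : ∑ p, ∑ q, a (max p.1 q.1) * ((ζ + η) p q * (ζ + η) q p) =
      ∑ p, ∑ q, a (max p.1 q.1) * (ζ p q * ζ q p) + ∑ p, ∑ q, a (max p.1 q.1) * (η p q * η q p) +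
        2 * ∑ p, ∑ q, a (max p.1 q.1) * (η p q * ζ q p) := by
    simp only [Finset.mul_sum, ← Finset.sum_add_distrib]
    refine Finset.sum_congr rfl fun p _ => Finset.sum_congr rfl fun q _ => ?_
    rw [Matrix.add_apply, Matrix.add_apply, hζ.1.apply p q, hη.1.apply p q]
    ring
  rw [hsum] at ks
  linarith

end Riesz

/-- Let `s ∈ Ξ` with all `s_k > 0`, and `R_s` the Riesz measure with
Laplace transform `δ_{-s}` on `𝒬`.  Then for every `T ∈ H`, the variance function of
`F(R_s)` satisfies `V(ρ(T) I) = (n_r/s_r) ρ(T) ∘ ρ*(T)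
  + Σ_{k=1}^{r-1} (n_k/s_k - n_{k+1}/s_{k+1}) ρ(T) ∘ ρ(J_k) ∘ ρ*(T)`
as a linear operator on `𝒵`, where `J_k = (I_{N_k})₀`. -/
theorem statement13 (r : ℕ) (n : Fin (r + 1) → ℕ+)
    (V : ∀ l k : Fin (r + 1), Submodule ℝ (Matrix (Fin (n l)) (Fin (n k)) ℝ))
    (hV1 : CondV1 V) (hV2 : CondV2 V) (hV3 : CondV3 V)
    (rstar : Mat r n → Mat r n → Mat r n)
    (hrstar : ∀ T ∈ Hgrp V, ∀ ξ ∈ Zspace V, rstar T ξ ∈ Zspace V ∧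
      ∀ x ∈ Zspace V, tip (rstar T ξ) x = tip ξ (rhoM T x))
    (δf : (Fin (r + 1) → ℝ) → Mat r n → ℝ)
    (hδ : ∀ s : Fin (r + 1) → ℝ, ∀ T ∈ Hgrp V, δf s (rstar T 1) = chi s T)
    (s : Fin (r + 1) → ℝ) (hs : s ∈ XiSet V) (hspos : ∀ k, 0 < s k)
    (μ : Measure (Mat r n)) (hμsupp : μ (Zspace V)ᶜ = 0)
    (hμL : ∀ ξ ∈ Qcone V, laplace μ ξ = ENNReal.ofReal (δf (-s) ξ))
    (ψ : Mat r n → Mat r n)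
    (hψ : ∀ m ∈ Pcone V, ψ m ∈ Qcone V ∧ meanMap μ (ψ m) = m) :
    ∀ T ∈ Hgrp V, ∀ ξ ∈ Zspace V,
      varOp μ (ψ (rhoM T 1)) (rhoM T 1) ξ
        = (((n (Fin.last r) : ℕ) : ℝ) / s (Fin.last r)) • rhoM T (rstar T ξ)
          + ∑ j : Fin r,
              ((((n j.castSucc : ℕ) : ℝ) / s j.castSucc - ((n j.succ : ℕ) : ℝ) / s j.succ))
                • rhoM T (rhoM (Jmat j.castSucc) (rstar T ξ)) := by
  intro T hT ξ hξ
  set a : Fin (r + 1) → ℝ := fun k => ((n k : ℕ) : ℝ) / s k with ha_def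
  have ha : ∀ k, 0 < a k := fun k => div_pos (by exact_mod_cast (n k).pos) (hspos k)
  have has : ∀ k, s k * a k = (n k : ℕ) := fun k => mul_div_cancel₀ _ (hspos k).ne'
  have hsupp : ∀ᵐ x ∂μ, x ∈ Zspace V := hμsupp
  have hfin : ∀ θ ∈ Qcone V, laplace μ θ ≠ ⊤ := fun θ hθ => by
    rw [hμL θ hθ]
    exact ENNReal.ofReal_ne_top
  have htrace : ∀ W ∈ Hgrp V, ∀ x ∈ Zspace V, tip (rstar W 1) x = (rhoM W x).trace :=
    fun W hW x hx => by rw [(hrstar W hW 1 one_mem_Zspace).2 x hx, tip_one_left]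
  have hQ : ∀ W ∈ Hgrp V, rstar W 1 ∈ Qcone V := fun W hW =>
    mem_Qcone_of_tip_eq hW (hrstar W hW 1 one_mem_Zspace).1 (htrace W hW)
  have hchi : ∀ W ∈ Hgrp V, 0 < chi (-s) W := fun W hW =>
    Finset.prod_pos fun k _ => Real.rpow_pos_of_pos ((mem_Hgrp_iff.1 hW).2 k) _
  have hLap : ∀ W ∈ Hgrp V, ∀ θ ∈ Zspace V, (∀ x ∈ Zspace V, tip θ x = (rhoM W x).trace) →
      laplaceR μ θ = chi (-s) W := fun W hW θ hθ h => by
    rw [eq_of_tip_eq hθ (hQ W hW).1 fun x hx => (h x hx).trans (htrace W hW x hx).symm,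
      laplaceR_eq_toReal, hμL _ (hQ W hW), hδ _ W hW, ENNReal.toReal_ofReal (hchi W hW).le]
  have hW : scaleDiag a * T⁻¹ ∈ Hgrp V := by
    simpa using (chi_curve (s := s) (u := 0) hV1 (scaleDiag_mem_Hgrp ha) one_mem_lowerAlg
      (inv_mem_Hgrp hV1 hT) (by simp)).1
  set θ₀ := rstar (scaleDiag a * T⁻¹) 1
  have hθ₀ : θ₀ ∈ Qcone V := hQ _ hW
  have h₀ := htrace _ hW
  have hC : 0 < laplaceR μ θ₀ := by
    rw [hLap _ hW θ₀ hθ₀.1 h₀]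
    exact hchi _ hW
  have hmean : ∀ α ∈ Zspace V,
      ∫ x, tip α x * Real.exp (-tip θ₀ x) ∂μ = laplaceR μ θ₀ * tip α (rhoM T 1) := by
    intro α hα
    obtain ⟨hζ, hζT⟩ := hrstar T hT α hα
    obtain ⟨β, hβ, hβB⟩ :=
      exists_tip_eq_trace_rhoM V (scaleDiag a * lowerPart a (rstar T α) * T⁻¹)
    exact (moments_riesz hV1 hV2 hV3 hfin hLap ha has hT hθ₀ h₀ hα hζ hβ hζT hβB).1
  have hm := (rhoM_one_mem_Pcone hV2 hV3 hT)
  obtain ⟨hψQ, hψm⟩ := hψ _ hm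
  have hμ : NeZero μ := ⟨fun h => by simp [h, laplaceR] at hC⟩
  have hLψ : laplaceR μ (ψ (rhoM T 1)) ≠ 0 :=
    (integral_exp_pos (integrable_exp_neg_tip (hfin _ hψQ))).ne'
  rw [varOp_eq_of_mean_eq hfin hψQ hθ₀
    (fun α _ => integral_tip_of_meanMap hsupp hfin hψQ hLψ hψm α) hmean]
  obtain ⟨hζ, hζT⟩ := hrstar T hT ξ hξ
  have hTl := (mem_Hgrp_iff.1 hT).1
  have hJ : ∀ k, rhoM (Jmat k) (rstar T ξ) ∈ Zspace V := fun k =>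
    rhoM_mem_Zspace hV1 hV2 hV3 (Jmat_mem_lowerAlg k) hζ
  have hR : a (Fin.last r) • rhoM T (rstar T ξ) + ∑ j : Fin r, (a j.castSucc - a j.succ) •
      rhoM T (rhoM (Jmat j.castSucc) (rstar T ξ)) ∈ Zspace V :=
    (Zsub V).add_mem ((Zsub V).smul_mem _ (rhoM_mem_Zspace hV1 hV2 hV3 hTl hζ))
      ((Zsub V).sum_mem fun j _ =>
        (Zsub V).smul_mem _ (rhoM_mem_Zspace hV1 hV2 hV3 hTl (hJ j.castSucc)))
  ext p q
  obtain ⟨e, he, hepq⟩ := exists_tip_eq_entry V p q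
  obtain ⟨hη, hηT⟩ := hrstar T hT e he
  have hI : ∫ x, Real.exp (-(tip θ₀ x)) * tip ξ (x - rhoM T 1) * ((x - rhoM T 1) p q) ∂μ =
      ∫ x, Real.exp (-tip θ₀ x) * tip ξ (x - rhoM T 1) * tip e (x - rhoM T 1) ∂μ := by
    refine integral_congr_ae ?_
    filter_upwards [hsupp] with x hx
    rw [hepq _ ((Zsub V).sub_mem hx hm.1)]
  rw [varOp, Matrix.of_apply, hI, integral_cov_riesz hV1 hV2 hV3 hfin hLap ha has hT hθ₀ h₀ hmean
    hξ he hζ hη hζT hηT, inv_mul_cancel_left₀ hC.ne', ← tip_telescope]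
  refine Eq.trans ?_ (hepq _ hR)
  have hsum : tip e (∑ j : Fin r, (a j.castSucc - a j.succ) •
      rhoM T (rhoM (Jmat j.castSucc) (rstar T ξ))) = ∑ j : Fin r, (a j.castSucc - a j.succ) *
        tip e (rhoM T (rhoM (Jmat j.castSucc) (rstar T ξ))) := by
    simp only [← tipForm_apply, map_sum, map_smul, smul_eq_mul]
  rw [tip_add_right, tip_smul_right, hsum, hηT _ hζ]
  congr 1
  exact Finset.sum_congr rfl fun j _ => by rw [hηT _ (hJ _)]

end Wishart
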